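/- Theorem 4. Let Ω̃^t = ⋂_{p ∈ [p₀,q)} ⋂_{α ∈ (α_, ᾱ]} L^p(V,w_α), endowed with the projective limit topology determined by the norms ‖·‖_{p,α} (a Fréchet space), and let 𝒢̃^t = {μ ∈ 𝒢 : μ(Ω̃^t) = 1}, its elements regarded as probability measures on Ω̃^t with its Borel σ-field. Then 𝒢̃^t is non-empty and compact in the weak topology of probability measures on Ω̃^t (the topology generated by bounded functions on Ω̃^t that are continuous in the Fréchet topology). -/

import Mathlib

open MeasureTheory Real Filter

noncomputable section

variable {V : Type} [Countable V] [DecidableEq V]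

/-- The configuration equal to `σ` on `Λ` and to `ξ` off `Λ`. -/
def comb (Λ : Finset V) (σ : ↥Λ → ℝ) (ξ : V → ℝ) : V → ℝ :=
  fun x => if h : x ∈ Λ then σ ⟨x, h⟩ else ξ x

/-- The relative local Hamiltonian `H_Λ(·|ξ)`, evaluated at the full configuration
`ω = ω_Λ × ξ_{Λᶜ}`: the sum of `W(ω(x),ω(y))` over edges with both ends in `Λ`,
plus the sum of `W(ω(x),ω(y))` over edges with `x ∈ Λ`, `y ∉ Λ`, plus `Σ_{x∈Λ} V(ω(x))`. -/
def ham (G : SimpleGraph V) [∀ v : V, Fintype (G.neighborSet v)]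
    (W : ℝ → ℝ → ℝ) (P : ℝ → ℝ) (Λ : Finset V) (ω : V → ℝ) : ℝ :=
  (∑ x ∈ Λ, ∑ y ∈ G.neighborFinset x ∩ Λ, W (ω x) (ω y)) / 2
    + ∑ x ∈ Λ, ∑ y ∈ G.neighborFinset x \ Λ, W (ω x) (ω y)
    + ∑ x ∈ Λ, P (ω x)

/-- The normalizing constant `Z_Λ(ξ)`. -/
def partZ (G : SimpleGraph V) [∀ v : V, Fintype (G.neighborSet v)]
    (W : ℝ → ℝ → ℝ) (P : ℝ → ℝ) (Λ : Finset V) (ξ : V → ℝ) : ℝ :=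
  ∫ σ : ↥Λ → ℝ, Real.exp (- ham G W P Λ (comb Λ σ ξ))

/-- The local Gibbs specification kernel `π_Λ(·|ξ)`, a measure on `Ω = ℝ^V`. -/
def gibbsKer (G : SimpleGraph V) [∀ v : V, Fintype (G.neighborSet v)]
    (W : ℝ → ℝ → ℝ) (P : ℝ → ℝ) (Λ : Finset V) (ξ : V → ℝ) : Measure (V → ℝ) :=
  (ENNReal.ofReal (partZ G W P Λ ξ))⁻¹ •
    Measure.map (fun σ => comb Λ σ ξ)
      ((volume : Measure (↥Λ → ℝ)).withDensity
        fun σ => ENNReal.ofReal (Real.exp (- ham G W P Λ (comb Λ σ ξ))))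

/-- `μ` is a Gibbs measure: a probability measure solving the DLR equation. -/
def IsGibbsMeasure (G : SimpleGraph V) [∀ v : V, Fintype (G.neighborSet v)]
    (W : ℝ → ℝ → ℝ) (P : ℝ → ℝ) (μ : Measure (V → ℝ)) : Prop :=
  IsProbabilityMeasure μ ∧
    ∀ (Λ : Finset V) (A : Set (V → ℝ)), MeasurableSet A →
      μ A = ∫⁻ ω, gibbsKer G W P Λ ω A ∂μ

/-- The weight `w_α(x) = exp(-α ρ(o,x))`. -/
def wgt (G : SimpleGraph V) (o : V) (α : ℝ) (x : V) : ℝ :=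
  Real.exp (-α * (G.dist o x : ℝ))

/-- `‖ω‖_{p,α}^p = Σ_{x∈V} |ω(x)|^p w_α(x)`. -/
def sNorm (G : SimpleGraph V) (o : V) (p α : ℝ) (ω : V → ℝ) : ℝ :=
  ∑' x : V, |ω x| ^ p * wgt G o α x

/-- The set `L^p(V, w_α)` of tempered configurations. -/
def tempered (G : SimpleGraph V) (o : V) (p α : ℝ) : Set (V → ℝ) :=
  {ω | Summable fun x : V => |ω x| ^ p * wgt G o α x}

/-- The summability `Θ(α,θ) = Σ_x Σ_{y∼x} [n(x)n(y)]^θ w_α(x) < ∞`. -/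
def ThetaFin (G : SimpleGraph V) [∀ v : V, Fintype (G.neighborSet v)]
    (o : V) (α θ : ℝ) : Prop :=
  Summable fun x : V =>
    (∑ y ∈ G.neighborFinset x, ((G.degree x : ℝ) * (G.degree y : ℝ)) ^ θ) * wgt G o α x

/-- The projective limit (Fréchet) topology on `Ω̃^t`, i.e. the coarsest topology
making all the norms `‖· - η‖_{p,α}`, `p ∈ [p₀,q)`, `α ∈ (α_,ᾱ]`, `η ∈ Ω̃^t`, continuous. -/
def projTop (G : SimpleGraph V) (o : V) (p0 q αlow αbar : ℝ) (Ωt : Set (V → ℝ)) :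
    TopologicalSpace ↥Ωt :=
  ⨅ (p : ℝ) (_ : p ∈ Set.Ico p0 q) (α : ℝ) (_ : α ∈ Set.Ioc αlow αbar) (η : ↥Ωt),
    TopologicalSpace.induced
      (fun ω : ↥Ωt => (∑' x : V, |ω.1 x - η.1 x| ^ p * wgt G o α x) ^ (1 / p))
      inferInstance

/-- The weak topology on measures on `X`: the topology generated by the maps
`μ ↦ ∫ f dμ`, `f` bounded and continuous (w.r.t. the topology `tX`). -/
def weakTop (X : Type) [MeasurableSpace X] (tX : TopologicalSpace X) :
    TopologicalSpace (Measure X) :=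
  ⨅ (f : X → ℝ) (_ : @Continuous X ℝ tX inferInstance f) (_ : ∃ M : ℝ, ∀ x : X, |f x| ≤ M),
    TopologicalSpace.induced (fun μ : Measure X => ∫ x, f x ∂μ) inferInstance

open scoped ENNReal NNReal Topology

set_option linter.unusedSectionVars false

/-- A Young-type inequality whose constant has explicit polynomial dependence on the scale `N`. -/
lemma exists_young_rpow {r p θ J κ : ℝ} (hr : 0 < r) (hp : r < p) (hθ : r / (p - r) ≤ θ)
    (hJ : 0 < J) (hκ : 0 < κ) :
    ∃ C : ℝ, 0 ≤ C ∧ ∀ t : ℝ, 0 ≤ t → ∀ N : ℝ, 1 ≤ N →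
      J * t ^ r ≤ κ / N * t ^ p + C * N ^ θ := by
  have hpr : 0 < p - r := by linarith
  refine ⟨J * (J / κ) ^ (r / (p - r)), by positivity, fun t ht N hN => ?_⟩
  have hN0 : 0 < N := by linarith
  rcases le_total (J * N / κ) (t ^ (p - r)) with h | h
  · have h1 : t ^ p = t ^ r * t ^ (p - r) := by
      rw [← Real.rpow_add_of_nonneg ht hr.le hpr.le]; congr 1; ring
    have h2 : J ≤ κ / N * t ^ (p - r) := by
      rw [div_le_iff₀ hκ] at h
      rw [div_mul_eq_mul_div, le_div_iff₀ hN0]; linarith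
    have h3 : 0 ≤ J * (J / κ) ^ (r / (p - r)) * N ^ θ := by positivity
    have h4 : 0 ≤ t ^ r := by positivity
    rw [h1]
    nlinarith [mul_le_mul_of_nonneg_right h2 h4]
  · have h1 : t ^ r ≤ (J * N / κ) ^ (r / (p - r)) := by
      have := Real.rpow_le_rpow (by positivity) h (by positivity : 0 ≤ r / (p - r))
      rwa [← Real.rpow_mul ht, mul_div_cancel₀ _ hpr.ne'] at this
    have h2 : (J * N / κ) ^ (r / (p - r)) = (J / κ) ^ (r / (p - r)) * N ^ (r / (p - r)) := by
      rw [← Real.mul_rpow (by positivity) hN0.le]; congr 1; ring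
    have h3 : N ^ (r / (p - r)) ≤ N ^ θ := Real.rpow_le_rpow_of_exponent_le hN hθ
    have h4 : 0 ≤ κ / N * t ^ p := by positivity
    calc J * t ^ r ≤ J * ((J / κ) ^ (r / (p - r)) * N ^ θ) := by
          rw [h2] at h1
          gcongr
          exact h1.trans (by gcongr)
      _ ≤ _ := by linarith

lemma exists_mul_rpow_le_add {r q b ε : ℝ} (hr : 0 < r) (hq : r < q) (hε : 0 < ε) :
    ∃ C : ℝ, ∀ t : ℝ, 0 ≤ t → b * t ^ r ≤ ε * t ^ q + C := by
  obtain ⟨C, -, h⟩ := exists_young_rpow (J := |b| + 1) hr hq le_rfl (by positivity) hε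
  refine ⟨C, fun t ht => ?_⟩
  have h1 := h t ht 1 le_rfl
  simp only [div_one, Real.one_rpow, mul_one] at h1
  refine le_trans ?_ h1
  gcongr
  linarith [le_abs_self b]

lemma integrable_exp_neg_mul_abs_rpow {q a : ℝ} (hq : 0 < q) (ha : 0 < a) :
    Integrable fun u : ℝ => Real.exp (-a * |u| ^ q) := by
  apply Integrable.of_integral_ne_zero
  rw [integral_comp_abs (f := fun u => Real.exp (-a * u ^ q)), integral_exp_neg_mul_rpow hq ha]
  have : 0 < Real.Gamma (1 / q + 1) := Real.Gamma_pos_of_pos (by positivity)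
  positivity

lemma continuous_abs_rpow {p : ℝ} (hp : 0 < p) : Continuous fun u : ℝ => |u| ^ p :=
  continuous_abs.rpow_const fun _ => Or.inr hp.le

lemma integrable_exp_abs_rpow {r p q a : ℝ} (b c d : ℝ) (hr : 0 < r) (hrq : r < q) (hp : 0 < p)
    (hpq : p < q) (ha : 0 < a) :
    Integrable fun u : ℝ => Real.exp (b * |u| ^ r + c * |u| ^ p - a * |u| ^ q + d) := by
  obtain ⟨C₁, h₁⟩ := exists_mul_rpow_le_add (b := b) hr hrq (by positivity : 0 < a / 4)
  obtain ⟨C₂, h₂⟩ := exists_mul_rpow_le_add (b := c) hp hpq (by positivity : 0 < a / 4)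
  have hq : 0 < q := hr.trans hrq
  refine ((integrable_exp_neg_mul_abs_rpow hq (half_pos ha)).const_mul
    (Real.exp (C₁ + C₂ + d))).mono' ?_ (ae_of_all _ fun u => ?_)
  · have := continuous_abs_rpow hr
    have := continuous_abs_rpow hp
    have := continuous_abs_rpow hq
    exact Continuous.aestronglyMeasurable (by fun_prop)
  · rw [Real.norm_of_nonneg (Real.exp_pos _).le, ← Real.exp_add]
    apply Real.exp_le_exp.mpr
    linarith [h₁ |u| (abs_nonneg u), h₂ |u| (abs_nonneg u)]

/-- The standing assumptions on the potentials `W` and `P`. -/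
structure IsStable (W : ℝ → ℝ → ℝ) (P : ℝ → ℝ) (IW JW r aV cV q : ℝ) : Prop where
  contW : Continuous (Function.uncurry W)
  symm : ∀ u v, W u v = W v u
  IW_pos : 0 < IW
  JW_pos : 0 < JW
  r_pos : 0 < r
  boundW : ∀ u v : ℝ, |W u v| ≤ (IW + JW * (|u| ^ r + |v| ^ r)) / 2
  contP : Continuous P
  aV_pos : 0 < aV
  r_lt : r < q
  boundP : ∀ u : ℝ, aV * |u| ^ q - cV ≤ P u

section Hamiltonian

variable {G : SimpleGraph V} [∀ v : V, Fintype (G.neighborSet v)] {W : ℝ → ℝ → ℝ} {P : ℝ → ℝ}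
  {IW JW r aV cV q : ℝ}

lemma continuous_ham (h : IsStable W P IW JW r aV cV q) (Λ : Finset V) :
    Continuous (ham G W P Λ) := by
  have hW : ∀ x y : V, Continuous fun ω : V → ℝ => W (ω x) (ω y) := fun x y =>
    h.contW.comp (f := fun ω : V → ℝ => (ω x, ω y))
      ((continuous_apply x).prodMk (continuous_apply y))
  have hP : ∀ x : V, Continuous fun ω : V → ℝ => P (ω x) := fun x =>
    h.contP.comp (continuous_apply x)
  exact ((((continuous_finsetSum _ fun x _ => continuous_finsetSum _ fun y _ => hW x y).div_const
    2).add (continuous_finsetSum _ fun x _ => continuous_finsetSum _ fun y _ => hW x y)).add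
    (continuous_finsetSum _ fun x _ => hP x))

lemma continuous_comb (Λ : Finset V) :
    Continuous fun z : (↥Λ → ℝ) × (V → ℝ) => comb Λ z.1 z.2 := by
  refine continuous_pi fun x => ?_
  by_cases hx : x ∈ Λ
  · simp only [comb, hx, dite_true]; fun_prop
  · simp only [comb, hx, dite_false]; fun_prop

lemma neg_ham_le (h : IsStable W P IW JW r aV cV q) (Λ : Finset V) :
    ∃ b c : ℝ, 0 ≤ b ∧ ∀ (ω : V → ℝ) (R : ℝ), 0 ≤ R →
      (∀ x ∈ Λ, ∀ y ∈ G.neighborFinset x, y ∉ Λ → |ω y| ^ r ≤ R) →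
      -ham G W P Λ ω ≤ c + b * R + ∑ z ∈ Λ, (b * |ω z| ^ r - aV * |ω z| ^ q + cV) := by
  have hJ := h.JW_pos
  have hI := h.IW_pos
  obtain ⟨D, hD⟩ : ∃ D : ℝ, D = ∑ x ∈ Λ, ((G.neighborFinset x).card : ℝ) := ⟨_, rfl⟩
  have hD0 : 0 ≤ D := hD ▸ Finset.sum_nonneg fun x _ => Nat.cast_nonneg _
  refine ⟨D * (2 * JW), D * IW, by positivity, fun ω R hR hω => ?_⟩
  set S : ℝ := ∑ z ∈ Λ, |ω z| ^ r with hS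
  have hS0 : 0 ≤ S := Finset.sum_nonneg fun z _ => by positivity
  have hle : ∀ z ∈ Λ, |ω z| ^ r ≤ S := fun z hz =>
    Finset.single_le_sum (f := fun z => |ω z| ^ r) (fun z _ => by positivity) hz
  have hedge : ∀ x ∈ Λ, ∀ y ∈ G.neighborFinset x,
      -W (ω x) (ω y) ≤ (IW + JW * (2 * S + R)) / 2 := by
    intro x hx y hy
    have h1 := (abs_le.mp (h.boundW (ω x) (ω y))).1
    have h2 : |ω y| ^ r ≤ S + R := by
      by_cases hyΛ : y ∈ Λ
      · linarith [hle y hyΛ]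
      · linarith [hω x hx y hy hyΛ]
    nlinarith [hle x hx]
  have hA0 : 0 ≤ (IW + JW * (2 * S + R)) / 2 := by positivity
  obtain ⟨A, hA⟩ : ∃ A, A = (IW + JW * (2 * S + R)) / 2 := ⟨_, rfl⟩
  rw [← hA] at hedge hA0
  have e1 : -(∑ x ∈ Λ, ∑ y ∈ G.neighborFinset x ∩ Λ, W (ω x) (ω y)) ≤
      ∑ x ∈ Λ, ∑ y ∈ G.neighborFinset x, A := by
    rw [← Finset.sum_neg_distrib]
    refine Finset.sum_le_sum fun x hx => ?_
    rw [← Finset.sum_neg_distrib]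
    refine (Finset.sum_le_sum fun y hy => hedge x hx y (Finset.mem_inter.mp hy).1).trans ?_
    exact Finset.sum_le_sum_of_subset_of_nonneg Finset.inter_subset_left fun _ _ _ => hA0
  have e2 : -(∑ x ∈ Λ, ∑ y ∈ G.neighborFinset x \ Λ, W (ω x) (ω y)) ≤
      ∑ x ∈ Λ, ∑ y ∈ G.neighborFinset x, A := by
    rw [← Finset.sum_neg_distrib]
    refine Finset.sum_le_sum fun x hx => ?_
    rw [← Finset.sum_neg_distrib]
    refine (Finset.sum_le_sum fun y hy => hedge x hx y (Finset.mem_sdiff.mp hy).1).trans ?_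
    exact Finset.sum_le_sum_of_subset_of_nonneg Finset.sdiff_subset fun _ _ _ => hA0
  have e3 : -(∑ x ∈ Λ, P (ω x)) ≤ ∑ x ∈ Λ, (cV - aV * |ω x| ^ q) := by
    rw [← Finset.sum_neg_distrib]
    exact Finset.sum_le_sum fun x _ => by linarith [h.boundP (ω x)]
  have e4 : (∑ x ∈ Λ, ∑ y ∈ G.neighborFinset x, A) = D * A := by
    rw [hD, Finset.sum_mul]
    exact Finset.sum_congr rfl fun x _ => by rw [Finset.sum_const, nsmul_eq_mul]
  have e5 : ∑ z ∈ Λ, (D * (2 * JW) * |ω z| ^ r - aV * |ω z| ^ q + cV) =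
      D * (2 * JW) * S + ∑ z ∈ Λ, (cV - aV * |ω z| ^ q) := by
    rw [hS, Finset.mul_sum, ← Finset.sum_add_distrib]
    exact Finset.sum_congr rfl fun _ _ => by ring
  rw [e5]
  unfold ham
  have e6 : 2 * (D * A) = D * IW + D * (2 * JW) * S + D * JW * R := by rw [hA]; ring
  have e7 : 0 ≤ D * JW * R := by positivity
  have e8 : 0 ≤ D * A := by positivity
  rw [e4] at e1 e2
  linarith

/-- An integrable envelope for the Boltzmann weights, uniform over bounded boundary conditions. -/
lemma exists_integrable_envelope (h : IsStable W P IW JW r aV cV q) (Λ : Finset V) {p : ℝ}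
    (hp : 0 < p) (hpq : p < q) (R : ℝ) (hR : 0 ≤ R) :
    ∃ g : (↥Λ → ℝ) → ℝ, Integrable g ∧ ∀ (ξ : V → ℝ),
      (∀ x ∈ Λ, ∀ y ∈ G.neighborFinset x, |ξ y| ^ r ≤ R) → ∀ σ : ↥Λ → ℝ,
      Real.exp (-ham G W P Λ (comb Λ σ ξ) + ∑ z, |σ z| ^ p) ≤ g σ := by
  obtain ⟨b, c, -, hb⟩ := neg_ham_le (G := G) h Λ
  refine ⟨fun σ => Real.exp (c + b * R) *
    ∏ z, Real.exp (b * |σ z| ^ r + 1 * |σ z| ^ p - aV * |σ z| ^ q + cV), ?_, fun ξ hξ σ => ?_⟩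
  · exact (Integrable.fintype_prod fun _ =>
      integrable_exp_abs_rpow b 1 cV h.r_pos h.r_lt hp hpq h.aV_pos).const_mul _
  · have h1 := hb (comb Λ σ ξ) R hR (fun x hx y hy hyΛ => by simpa [comb, hyΛ] using hξ x hx y hy)
    rw [← Finset.sum_coe_sort] at h1
    have h2 : ∀ z : ↥Λ, comb Λ σ ξ z = σ z := fun z => by simp [comb]
    simp only [h2] at h1
    beta_reduce
    rw [← Real.exp_sum, ← Real.exp_add]
    apply Real.exp_le_exp.mpr
    have h3 : ∑ z : ↥Λ, (b * |σ z| ^ r + 1 * |σ z| ^ p - aV * |σ z| ^ q + cV) =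
      ∑ z : ↥Λ, (b * |σ z| ^ r - aV * |σ z| ^ q + cV) + ∑ z : ↥Λ, |σ z| ^ p := by
      rw [← Finset.sum_add_distrib]
      exact Finset.sum_congr rfl fun _ _ => by ring
    rw [h3]
    linarith

lemma abs_rpow_le_boundary_sum (Λ : Finset V) (ξ : V → ℝ) (x : V) (hx : x ∈ Λ) (y : V)
    (hy : y ∈ G.neighborFinset x) :
    |ξ y| ^ r ≤ ∑ x ∈ Λ, ∑ y ∈ G.neighborFinset x, |ξ y| ^ r :=
  (Finset.single_le_sum (f := fun y => |ξ y| ^ r) (fun z _ => by positivity) hy).trans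
    (Finset.single_le_sum (f := fun x => ∑ y ∈ G.neighborFinset x, |ξ y| ^ r)
      (fun z _ => by positivity) hx)

lemma integrable_boltzmann_moment (h : IsStable W P IW JW r aV cV q) (Λ : Finset V) {p : ℝ}
    (hp : 0 < p) (hpq : p < q) (ξ : V → ℝ) :
    Integrable fun σ : ↥Λ → ℝ =>
      Real.exp (-ham G W P Λ (comb Λ σ ξ) + ∑ z, |σ z| ^ p) := by
  obtain ⟨g, hg, hle⟩ := exists_integrable_envelope (G := G) h Λ hp hpq
    (∑ x ∈ Λ, ∑ y ∈ G.neighborFinset x, |ξ y| ^ r) (by positivity)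
  refine hg.mono' ?_ (ae_of_all _ fun σ => ?_)
  · have h1 : Continuous fun σ : ↥Λ → ℝ => ham G W P Λ (comb Λ σ ξ) :=
      (continuous_ham h Λ).comp ((continuous_comb Λ).comp (by fun_prop :
        Continuous fun σ : ↥Λ → ℝ => (σ, ξ)))
    have h2 : ∀ z : ↥Λ, Continuous fun σ : ↥Λ → ℝ => |σ z| ^ p := fun z =>
      (continuous_abs_rpow hp).comp (continuous_apply z)
    exact (Real.continuous_exp.comp
      (h1.neg.add (continuous_finsetSum _ fun z _ => h2 z))).aestronglyMeasurable
  · rw [Real.norm_of_nonneg (Real.exp_pos _).le]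
    exact hle ξ (abs_rpow_le_boundary_sum Λ ξ) σ

lemma continuous_boltzmann_integral (h : IsStable W P IW JW r aV cV q) (Λ : Finset V)
    (f : BoundedContinuousFunction (V → ℝ) ℝ) :
    Continuous fun ξ : V → ℝ =>
      ∫ σ : ↥Λ → ℝ, Real.exp (-ham G W P Λ (comb Λ σ ξ)) * f (comb Λ σ ξ) := by
  have hcont : Continuous fun z : (↥Λ → ℝ) × (V → ℝ) =>
      Real.exp (-ham G W P Λ (comb Λ z.1 z.2)) * f (comb Λ z.1 z.2) := by
    have h1 := (continuous_ham (G := G) h Λ).comp (continuous_comb Λ)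
    have h2 := f.continuous.comp (continuous_comb Λ)
    exact (Real.continuous_exp.comp h1.neg).mul h2
  have hq : 0 < q := h.r_pos.trans h.r_lt
  refine continuous_iff_continuousAt.mpr fun ξ₀ => ?_
  set B : (V → ℝ) → ℝ := fun ξ => ∑ x ∈ Λ, ∑ y ∈ G.neighborFinset x, |ξ y| ^ r with hB
  have hBc : Continuous B := by
    have := continuous_abs_rpow h.r_pos
    have h3 : ∀ y : V, Continuous fun ξ : V → ℝ => |ξ y| ^ r := fun y =>
      this.comp (continuous_apply y)
    fun_prop
  have hB0 : ∀ ξ, 0 ≤ B ξ := fun ξ => by positivity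
  obtain ⟨g, hg, hle⟩ := exists_integrable_envelope (G := G) h Λ (half_pos hq) (half_lt_self hq)
    (B ξ₀ + 1) (by linarith [hB0 ξ₀])
  refine continuousAt_of_dominated (bound := fun σ => g σ * ‖f‖) ?_ ?_ (hg.mul_const _) ?_
  · exact Eventually.of_forall fun ξ =>
      (hcont.comp (by fun_prop : Continuous fun σ : ↥Λ → ℝ => (σ, ξ))).aestronglyMeasurable
  · filter_upwards [hBc.continuousAt.eventually_lt continuousAt_const (lt_add_one (B ξ₀))]
      with ξ hξ
    refine ae_of_all _ fun σ => ?_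
    rw [norm_mul, Real.norm_of_nonneg (Real.exp_pos _).le]
    refine mul_le_mul (le_trans ?_ (hle ξ (fun x hx y hy =>
      (abs_rpow_le_boundary_sum Λ ξ x hx y hy).trans hξ.le) σ)) (f.norm_coe_le_norm _)
      (norm_nonneg _) (le_trans (Real.exp_pos _).le (hle ξ (fun x hx y hy =>
      (abs_rpow_le_boundary_sum Λ ξ x hx y hy).trans hξ.le) σ))
    apply Real.exp_le_exp.mpr
    have : 0 ≤ ∑ z : ↥Λ, |σ z| ^ (q / 2) := by positivity
    linarith
  · exact ae_of_all _ fun σ =>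
      (hcont.comp (by fun_prop : Continuous fun ξ : V → ℝ => (σ, ξ))).continuousAt

lemma integrable_boltzmann (h : IsStable W P IW JW r aV cV q) (Λ : Finset V) (ξ : V → ℝ) :
    Integrable fun σ : ↥Λ → ℝ => Real.exp (-ham G W P Λ (comb Λ σ ξ)) := by
  have hq : 0 < q := h.r_pos.trans h.r_lt
  refine (integrable_boltzmann_moment (G := G) h Λ (half_pos hq) (half_lt_self hq) ξ).mono' ?_
    (ae_of_all _ fun σ => ?_)
  · exact (Real.continuous_exp.comp (((continuous_ham h Λ).comp ((continuous_comb Λ).comp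
      (by fun_prop : Continuous fun σ : ↥Λ → ℝ => (σ, ξ)))).neg)).aestronglyMeasurable
  · rw [Real.norm_of_nonneg (Real.exp_pos _).le]
    apply Real.exp_le_exp.mpr
    have : 0 ≤ ∑ z : ↥Λ, |σ z| ^ (q / 2) := by positivity
    linarith

lemma partZ_pos (h : IsStable W P IW JW r aV cV q) (Λ : Finset V) (ξ : V → ℝ) :
    0 < partZ G W P Λ ξ :=
  integral_exp_pos (integrable_boltzmann h Λ ξ)

end Hamiltonian

section Kernel

variable {G : SimpleGraph V} [∀ v : V, Fintype (G.neighborSet v)] {W : ℝ → ℝ → ℝ} {P : ℝ → ℝ}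
  {IW JW r aV cV q : ℝ}

/-- The unnormalised Boltzmann density of the local Hamiltonian. -/
def boltzmann (G : SimpleGraph V) [∀ v : V, Fintype (G.neighborSet v)]
    (W : ℝ → ℝ → ℝ) (P : ℝ → ℝ) (Λ : Finset V) (ω : V → ℝ) : ℝ≥0∞ :=
  ENNReal.ofReal (Real.exp (-ham G W P Λ ω))

lemma measurable_boltzmann (h : IsStable W P IW JW r aV cV q) (Λ : Finset V) :
    Measurable (boltzmann G W P Λ) :=
  (Real.continuous_exp.comp (continuous_ham h Λ).neg).measurable.ennreal_ofReal

lemma measurable_comb (Λ : Finset V) (ξ : V → ℝ) :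
    Measurable fun σ : ↥Λ → ℝ => comb Λ σ ξ :=
  measurable_updateFinset

lemma ofReal_partZ (h : IsStable W P IW JW r aV cV q) (Λ : Finset V) (ξ : V → ℝ) :
    ENNReal.ofReal (partZ G W P Λ ξ) =
      (∫⋯∫⁻_Λ, boltzmann G W P Λ ∂fun _ => volume) ξ :=
  ofReal_integral_eq_lintegral_ofReal (integrable_boltzmann h Λ ξ)
    (ae_of_all _ fun _ => (Real.exp_pos _).le)

lemma lintegral_gibbsKer (h : IsStable W P IW JW r aV cV q) (Λ : Finset V) (ξ : V → ℝ)
    {f : (V → ℝ) → ℝ≥0∞} (hf : Measurable f) :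
    ∫⁻ ω, f ω ∂gibbsKer G W P Λ ξ = (ENNReal.ofReal (partZ G W P Λ ξ))⁻¹ *
      (∫⋯∫⁻_Λ, (fun ω => boltzmann G W P Λ ω * f ω) ∂fun _ => volume) ξ := by
  have hm := measurable_comb Λ ξ
  rw [gibbsKer, lintegral_smul_measure, lintegral_map hf hm, smul_eq_mul]
  congr 1
  exact lintegral_withDensity_eq_lintegral_mul _ ((measurable_boltzmann (G := G) h Λ).comp hm)
    (hf.comp hm)

lemma gibbsKer_apply (h : IsStable W P IW JW r aV cV q) (Λ : Finset V) (ξ : V → ℝ)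
    {A : Set (V → ℝ)} (hA : MeasurableSet A) :
    gibbsKer G W P Λ ξ A = (ENNReal.ofReal (partZ G W P Λ ξ))⁻¹ *
      (∫⋯∫⁻_Λ, (fun ω => boltzmann G W P Λ ω * A.indicator 1 ω) ∂fun _ => volume) ξ := by
  rw [← lintegral_gibbsKer h Λ ξ (measurable_one.indicator hA), lintegral_indicator_one hA]

lemma isProbabilityMeasure_gibbsKer (h : IsStable W P IW JW r aV cV q) (Λ : Finset V)
    (ξ : V → ℝ) : IsProbabilityMeasure (gibbsKer G W P Λ ξ) := by
  refine ⟨?_⟩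
  rw [gibbsKer_apply h Λ ξ MeasurableSet.univ]
  simp only [Set.indicator_univ, Pi.one_apply, mul_one]
  rw [ofReal_partZ h Λ ξ]
  refine ENNReal.inv_mul_cancel ?_ ?_ <;> rw [← ofReal_partZ h Λ ξ]
  · simpa using partZ_pos h Λ ξ
  · exact ENNReal.ofReal_ne_top

lemma measurable_partZ (h : IsStable W P IW JW r aV cV q) (Λ : Finset V) :
    Measurable fun ξ => ENNReal.ofReal (partZ G W P Λ ξ) := by
  simp_rw [ofReal_partZ h Λ]
  exact (measurable_boltzmann h Λ).lmarginal _

lemma measurable_lintegral_gibbsKer (h : IsStable W P IW JW r aV cV q) (Λ : Finset V)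
    {f : (V → ℝ) → ℝ≥0∞} (hf : Measurable f) :
    Measurable fun ξ => ∫⁻ ω, f ω ∂gibbsKer G W P Λ ξ := by
  simp_rw [lintegral_gibbsKer h Λ _ hf]
  exact (measurable_partZ h Λ).inv.mul (((measurable_boltzmann h Λ).mul hf).lmarginal _)

lemma measurable_gibbsKer (h : IsStable W P IW JW r aV cV q) (Λ : Finset V) :
    Measurable (gibbsKer G W P Λ) := by
  refine Measure.measurable_of_measurable_coe _ fun A hA => ?_
  simp_rw [← lintegral_indicator_one hA]
  exact measurable_lintegral_gibbsKer h Λ (measurable_one.indicator hA)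

lemma gibbsKer_ae_eq_off (h : IsStable W P IW JW r aV cV q) (Λ : Finset V) (ξ : V → ℝ) :
    ∀ᵐ ω ∂gibbsKer G W P Λ ξ, ∀ x ∉ Λ, ω x = ξ x := by
  refine ae_all_iff.mpr fun x => ?_
  by_cases hx : x ∈ Λ
  · exact ae_of_all _ fun ω hx' => absurd hx hx'
  have hA : MeasurableSet {ω : V → ℝ | ω x ≠ ξ x} :=
    (measurableSet_eq_fun (measurable_pi_apply x) measurable_const).compl
  have : gibbsKer G W P Λ ξ {ω : V → ℝ | ω x ≠ ξ x} = 0 := by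
    rw [gibbsKer_apply h Λ ξ hA]
    have : (∫⋯∫⁻_Λ, (fun ω => boltzmann G W P Λ ω *
        ({ω : V → ℝ | ω x ≠ ξ x}).indicator 1 ω) ∂fun _ => volume) ξ = 0 := by
      simp [lmarginal, Function.updateFinset, hx]
    rw [this, mul_zero]
  rw [ae_iff]
  refine measure_mono_null (fun ω hω => ?_) this
  simp only [Set.mem_ofPred_eq] at hω ⊢
  tauto

lemma sum_neighbor_comm (hW : ∀ u v, W u v = W v u) (A B : Finset V) (ω : V → ℝ) :
    ∑ x ∈ A, ∑ y ∈ G.neighborFinset x ∩ B, W (ω x) (ω y) =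
      ∑ x ∈ B, ∑ y ∈ G.neighborFinset x ∩ A, W (ω x) (ω y) := by
  rw [Finset.sum_comm' (t' := B) (s' := fun y => G.neighborFinset y ∩ A)]
  · exact Finset.sum_congr rfl fun x _ => Finset.sum_congr rfl fun y _ => hW _ _
  · intro x y
    simp only [Finset.mem_inter, SimpleGraph.mem_neighborFinset, G.adj_comm x y]
    tauto

/-- Enlarging the volume changes the Hamiltonian by a term not depending on the smaller volume. -/
lemma ham_sub_ham (hW : ∀ u v, W u v = W v u) {Δ Λ : Finset V} (hs : Δ ⊆ Λ) (ω : V → ℝ) :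
    ham G W P Λ ω = ham G W P Δ ω +
      ((∑ x ∈ Λ \ Δ, ∑ y ∈ G.neighborFinset x ∩ (Λ \ Δ), W (ω x) (ω y)) / 2
        + ∑ x ∈ Λ \ Δ, ∑ y ∈ G.neighborFinset x \ Λ, W (ω x) (ω y) + ∑ x ∈ Λ \ Δ, P (ω x)) := by
  have hsplit : ∀ f : V → ℝ, ∑ x ∈ Λ, f x = ∑ x ∈ Λ \ Δ, f x + ∑ x ∈ Δ, f x := fun f =>
    (Finset.sum_sdiff hs).symm
  have hin : ∀ x, ∑ y ∈ G.neighborFinset x ∩ Λ, W (ω x) (ω y) =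
      ∑ y ∈ G.neighborFinset x ∩ (Λ \ Δ), W (ω x) (ω y) +
        ∑ y ∈ G.neighborFinset x ∩ Δ, W (ω x) (ω y) := fun x => by
    rw [← Finset.sum_union]
    · congr 1
      rw [← Finset.inter_union_distrib_left, Finset.sdiff_union_of_subset hs]
    · exact Finset.disjoint_sdiff.symm.mono Finset.inter_subset_right Finset.inter_subset_right
  have hout : ∀ x, ∑ y ∈ G.neighborFinset x \ Δ, W (ω x) (ω y) =
      ∑ y ∈ G.neighborFinset x ∩ (Λ \ Δ), W (ω x) (ω y) +
        ∑ y ∈ G.neighborFinset x \ Λ, W (ω x) (ω y) := fun x => by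
    rw [← Finset.sum_union]
    · congr 1
      ext y
      simp only [Finset.mem_sdiff, Finset.mem_union, Finset.mem_inter]
      have := @hs y
      tauto
    · exact Finset.disjoint_left.mpr fun y hy hy' => by
        simp only [Finset.mem_sdiff, Finset.mem_inter] at hy hy'
        tauto
  have hcomm := sum_neighbor_comm (G := G) hW (Λ \ Δ) Δ ω
  simp only [ham, hsplit, hin, hout, Finset.sum_add_distrib]
  rw [hcomm]
  ring

lemma boltzmann_mul (hW : ∀ u v, W u v = W v u) {Δ Λ : Finset V} (hs : Δ ⊆ Λ) :
    ∃ k : (V → ℝ) → ℝ≥0∞, (∀ ω ω' : V → ℝ, (∀ x ∉ Δ, ω x = ω' x) → k ω = k ω') ∧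
      ∀ ω, boltzmann G W P Λ ω = k ω * boltzmann G W P Δ ω := by
  refine ⟨fun ω => ENNReal.ofReal (Real.exp (-((∑ x ∈ Λ \ Δ,
    ∑ y ∈ G.neighborFinset x ∩ (Λ \ Δ), W (ω x) (ω y)) / 2
    + ∑ x ∈ Λ \ Δ, ∑ y ∈ G.neighborFinset x \ Λ, W (ω x) (ω y) + ∑ x ∈ Λ \ Δ, P (ω x)))),
    fun ω ω' hω => ?_, fun ω => ?_⟩
  · have h1 : ∀ x ∈ Λ \ Δ, ω x = ω' x := fun x hx => hω x (Finset.mem_sdiff.mp hx).2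
    have e1 : (∑ x ∈ Λ \ Δ, ∑ y ∈ G.neighborFinset x ∩ (Λ \ Δ), W (ω x) (ω y)) =
        ∑ x ∈ Λ \ Δ, ∑ y ∈ G.neighborFinset x ∩ (Λ \ Δ), W (ω' x) (ω' y) :=
      Finset.sum_congr rfl fun x hx => Finset.sum_congr rfl fun y hy => by
        rw [h1 x hx, h1 y (Finset.mem_inter.mp hy).2]
    have e2 : (∑ x ∈ Λ \ Δ, ∑ y ∈ G.neighborFinset x \ Λ, W (ω x) (ω y)) =
        ∑ x ∈ Λ \ Δ, ∑ y ∈ G.neighborFinset x \ Λ, W (ω' x) (ω' y) :=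
      Finset.sum_congr rfl fun x hx => Finset.sum_congr rfl fun y hy => by
        rw [h1 x hx, hω y fun hy' => (Finset.mem_sdiff.mp hy).2 (hs hy')]
    have e3 : (∑ x ∈ Λ \ Δ, P (ω x)) = ∑ x ∈ Λ \ Δ, P (ω' x) :=
      Finset.sum_congr rfl fun x hx => by rw [h1 x hx]
    beta_reduce
    rw [e1, e2, e3]
  · rw [boltzmann, ham_sub_ham hW hs, neg_add, Real.exp_add,
      ENNReal.ofReal_mul (Real.exp_pos _).le, mul_comm]
    rfl

lemma lmarginal_mul_of_indep {Δ : Finset V} {g : (V → ℝ) → ℝ≥0∞} (f : (V → ℝ) → ℝ≥0∞)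
    (hf : Measurable f)
    (hg : ∀ ω ω' : V → ℝ, (∀ x ∉ Δ, ω x = ω' x) → g ω = g ω') :
    ∫⋯∫⁻_Δ, (fun ω => g ω * f ω) ∂(fun _ => volume) =
      fun ξ => g ξ * (∫⋯∫⁻_Δ, f ∂fun _ => volume) ξ := by
  ext ξ
  simp only [lmarginal]
  refine Eq.trans ?_ (lintegral_const_mul _ (hf.comp measurable_updateFinset))
  refine lintegral_congr fun σ => ?_
  rw [hg _ ξ fun x hx => by simp [Function.updateFinset, hx]]

/-- Consistency of the local Gibbs specification. -/
lemma lintegral_gibbsKer_consistent (h : IsStable W P IW JW r aV cV q) {Δ Λ : Finset V}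
    (hs : Δ ⊆ Λ) (ξ : V → ℝ) {f : (V → ℝ) → ℝ≥0∞} (hf : Measurable f) :
    ∫⁻ η, ∫⁻ ω, f ω ∂gibbsKer G W P Δ η ∂gibbsKer G W P Λ ξ =
      ∫⁻ ω, f ω ∂gibbsKer G W P Λ ξ := by
  have hm := measurable_lintegral_gibbsKer (G := G) h Δ hf
  rw [lintegral_gibbsKer h Λ ξ hm, lintegral_gibbsKer h Λ ξ hf]
  congr 1
  have hρ := measurable_boltzmann (G := G) h Λ
  have hρΔ := measurable_boltzmann (G := G) h Δ
  refine congrFun (lmarginal_eq_of_subset hs (hρ.mul hm) (hρ.mul hf) ?_) ξ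
  obtain ⟨k, hk, hkρ⟩ := boltzmann_mul (G := G) (P := P) h.symm hs
  have hind : ∀ {g : (V → ℝ) → ℝ≥0∞}, ∀ ω ω' : V → ℝ, (∀ x ∉ Δ, ω x = ω' x) →
      (∫⋯∫⁻_Δ, g ∂fun _ => volume) ω = (∫⋯∫⁻_Δ, g ∂fun _ => volume) ω' :=
    fun ω ω' hω => lmarginal_congr _ _ hω
  have e1 : ∫⋯∫⁻_Δ, (fun ω => boltzmann G W P Λ ω * f ω) ∂(fun _ => volume) =
      fun ξ => k ξ * (∫⋯∫⁻_Δ, (fun ω => boltzmann G W P Δ ω * f ω) ∂fun _ => volume) ξ := by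
    refine Eq.trans ?_ (lmarginal_mul_of_indep _ (hρΔ.mul hf) hk)
    simp only [hkρ, mul_assoc]
  have e2 : ∫⋯∫⁻_Δ, (fun ω => boltzmann G W P Λ ω * ∫⁻ ω', f ω' ∂gibbsKer G W P Δ ω)
        ∂(fun _ => volume) =
      fun ξ => (k ξ * ∫⁻ ω', f ω' ∂gibbsKer G W P Δ ξ) *
        (∫⋯∫⁻_Δ, boltzmann G W P Δ ∂fun _ => volume) ξ := by
    rw [← lmarginal_mul_of_indep _ hρΔ]
    · congr 1
      ext ω
      rw [hkρ]; ring
    · intro ω ω' hω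
      simp only [lintegral_gibbsKer h Δ _ hf, ofReal_partZ h Δ]
      rw [hk ω ω' hω, hind ω ω' hω, hind ω ω' hω]
  refine e2.trans (Eq.trans ?_ e1.symm)
  ext η
  rw [lintegral_gibbsKer h Δ η hf, ofReal_partZ h Δ]
  have h0 : (∫⋯∫⁻_Δ, boltzmann G W P Δ ∂fun _ => volume) η ≠ 0 := by
    rw [← ofReal_partZ h Δ]; simpa using partZ_pos h Δ η
  have ht : (∫⋯∫⁻_Δ, boltzmann G W P Δ ∂fun _ => volume) η ≠ ⊤ := by
    rw [← ofReal_partZ h Δ]; exact ENNReal.ofReal_ne_top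
  rw [mul_assoc, mul_right_comm, ENNReal.inv_mul_cancel h0 ht, one_mul]

lemma integral_gibbsKer (h : IsStable W P IW JW r aV cV q) (Λ : Finset V) (ξ : V → ℝ)
    (f : BoundedContinuousFunction (V → ℝ) ℝ) :
    ∫ ω, f ω ∂gibbsKer G W P Λ ξ = (partZ G W P Λ ξ)⁻¹ *
      ∫ σ : ↥Λ → ℝ, Real.exp (-ham G W P Λ (comb Λ σ ξ)) * f (comb Λ σ ξ) := by
  have hm := measurable_comb Λ ξ
  have hc : Measurable fun σ : ↥Λ → ℝ => Real.exp (-ham G W P Λ (comb Λ σ ξ)) :=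
    (Real.continuous_exp.comp (continuous_ham h Λ).neg).measurable.comp hm
  rw [gibbsKer, integral_smul_measure, integral_map hm.aemeasurable
    f.continuous.aestronglyMeasurable]
  rw [ENNReal.toReal_inv, ENNReal.toReal_ofReal (partZ_pos h Λ ξ).le, smul_eq_mul]
  congr 1
  rw [integral_withDensity_eq_integral_toReal_smul hc.ennreal_ofReal
    (ae_of_all _ fun _ => ENNReal.ofReal_lt_top)]
  refine integral_congr_ae (ae_of_all _ fun σ => ?_)
  simp only [ENNReal.toReal_ofReal (Real.exp_pos _).le, smul_eq_mul]

/-- The Feller property of the local Gibbs specification. -/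
lemma continuous_integral_gibbsKer (h : IsStable W P IW JW r aV cV q) (Λ : Finset V)
    (f : BoundedContinuousFunction (V → ℝ) ℝ) :
    Continuous fun ξ => ∫ ω, f ω ∂gibbsKer G W P Λ ξ := by
  simp_rw [integral_gibbsKer h Λ _ f]
  refine Continuous.mul (Continuous.inv₀ ?_ fun ξ => (partZ_pos h Λ ξ).ne')
    (continuous_boltzmann_integral h Λ f)
  have := continuous_boltzmann_integral (G := G) h Λ (BoundedContinuousFunction.const _ 1)
  simp only [BoundedContinuousFunction.const_apply, mul_one] at this
  exact this

end Kernel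

section OnePoint

variable {G : SimpleGraph V} [∀ v : V, Fintype (G.neighborSet v)] {W : ℝ → ℝ → ℝ} {P : ℝ → ℝ}
  {IW JW r aV cV q : ℝ}

lemma exists_edge_bound (h : IsStable W P IW JW r aV cV q) {p θ κ : ℝ} (hp : r < p)
    (hθ : r / (p - r) ≤ θ) (hκ : 0 < κ) :
    ∃ C : ℝ, 0 ≤ C ∧ ∀ u v N : ℝ, 1 ≤ N →
      |W u v| ≤ κ / N * (|u| ^ p + |v| ^ p) + C * N ^ θ := by
  obtain ⟨C, hC, hY⟩ := exists_young_rpow h.r_pos hp hθ (half_pos h.JW_pos) hκ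
  have hI := h.IW_pos
  refine ⟨IW / 2 + 2 * C, by positivity, fun u v N hN => (h.boundW u v).trans ?_⟩
  have hθ0 : 0 ≤ θ := (div_nonneg h.r_pos.le (sub_pos.mpr hp).le).trans hθ
  have h1 : 1 ≤ N ^ θ := Real.one_le_rpow hN hθ0
  nlinarith [hY |u| (abs_nonneg u) N hN, hY |v| (abs_nonneg v) N hN]

lemma ham_singleton (x : V) (ω : V → ℝ) :
    ham G W P {x} ω = ∑ y ∈ G.neighborFinset x, W (ω x) (ω y) + P (ω x) := by
  have h1 : G.neighborFinset x ∩ {x} = ∅ := by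
    rw [Finset.inter_singleton_of_notMem]; simp
  have h2 : G.neighborFinset x \ {x} = G.neighborFinset x := by
    rw [Finset.sdiff_singleton_eq_erase, Finset.erase_eq_of_notMem]; simp
  simp [ham, h1, h2]

/-- The vertex quantity `m_θ(x) = Σ_{y∼x} [n(x)n(y)]^θ`. -/
def mTheta (G : SimpleGraph V) [∀ v : V, Fintype (G.neighborSet v)] (θ : ℝ) (x : V) : ℝ :=
  ∑ y ∈ G.neighborFinset x, ((G.degree x : ℝ) * (G.degree y : ℝ)) ^ θ

lemma mTheta_nonneg (θ : ℝ) (x : V) : 0 ≤ mTheta G θ x :=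
  Finset.sum_nonneg fun y _ => by positivity

lemma one_le_degree_of_adj {x y : V} (hxy : G.Adj x y) : (1 : ℝ) ≤ G.degree y := by
  exact_mod_cast (G.degree_pos_iff_exists_adj y).mpr ⟨x, hxy.symm⟩

lemma exists_vertex_bound (h : IsStable W P IW JW r aV cV q) {p θ κ : ℝ} (hp : r < p)
    (hθ : r / (p - r) ≤ θ) (hκ : 0 < κ) :
    ∃ C : ℝ, 0 ≤ C ∧ ∀ (x : V) (ω : V → ℝ),
      |∑ y ∈ G.neighborFinset x, W (ω x) (ω y)| ≤ κ * |ω x| ^ p +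
        (∑ y ∈ G.neighborFinset x, κ / (G.degree x * G.degree y) * |ω y| ^ p
          + C * mTheta G θ x) := by
  obtain ⟨C, hC, hE⟩ := exists_edge_bound h hp hθ hκ
  refine ⟨C, hC, fun x ω => (Finset.abs_sum_le_sum_abs _ _).trans ?_⟩
  have h1 : ∑ y ∈ G.neighborFinset x, κ / ((G.degree x : ℝ) * G.degree y) ≤ κ := by
    calc ∑ y ∈ G.neighborFinset x, κ / ((G.degree x : ℝ) * G.degree y)
        ≤ ∑ y ∈ G.neighborFinset x, κ / (G.degree x : ℝ) := by
          refine Finset.sum_le_sum fun y hy => ?_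
          rw [SimpleGraph.mem_neighborFinset] at hy
          have hx := one_le_degree_of_adj hy.symm
          have hy := one_le_degree_of_adj hy
          gcongr
          nlinarith
      _ = G.degree x * (κ / G.degree x) := by
          rw [Finset.sum_const, SimpleGraph.card_neighborFinset_eq_degree, nsmul_eq_mul]
      _ ≤ κ := by
          rcases eq_or_ne (G.degree x : ℝ) 0 with h0 | h0
          · rw [h0]; simp [hκ.le]
          · rw [mul_div_cancel₀ _ h0]
  have h2 : 0 ≤ |ω x| ^ p := by positivity
  calc ∑ y ∈ G.neighborFinset x, |W (ω x) (ω y)|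
      ≤ ∑ y ∈ G.neighborFinset x, (κ / ((G.degree x : ℝ) * G.degree y) * |ω x| ^ p +
          (κ / ((G.degree x : ℝ) * G.degree y) * |ω y| ^ p +
            C * ((G.degree x : ℝ) * G.degree y) ^ θ)) := by
        refine Finset.sum_le_sum fun y hy => ?_
        rw [SimpleGraph.mem_neighborFinset] at hy
        have hx := one_le_degree_of_adj hy.symm
        have hy := one_le_degree_of_adj hy
        refine (hE (ω x) (ω y) (G.degree x * G.degree y) (by nlinarith)).trans_eq (by ring)
    _ ≤ _ := by
        rw [Finset.sum_add_distrib, Finset.sum_add_distrib, ← Finset.sum_mul, ← Finset.mul_sum,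
          mTheta]
        gcongr

lemma lintegral_singleton_exp_le (h : IsStable W P IW JW r aV cV q) {p κ : ℝ} {x : V}
    {ξ : V → ℝ} {B : ℝ}
    (hB : ∀ u : ℝ, |∑ y ∈ G.neighborFinset x, W u (ξ y)| ≤ κ * |u| ^ p + B) (hp : 0 < p) :
    ∫⁻ ω, ENNReal.ofReal (Real.exp (|ω x| ^ p - 2 * B)) ∂gibbsKer G W P {x} ξ ≤
      (∫⁻ u : ℝ, ENNReal.ofReal (Real.exp ((1 + κ) * |u| ^ p - P u))) /
        ∫⁻ u : ℝ, ENNReal.ofReal (Real.exp (-κ * |u| ^ p - P u)) := by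
  have hcp := continuous_abs_rpow hp
  have hcP := h.contP
  have hm : Measurable fun ω : V → ℝ => ENNReal.ofReal (Real.exp (|ω x| ^ p - 2 * B)) := by
    have : Continuous fun ω : V → ℝ => |ω x| ^ p := hcp.comp (continuous_apply x)
    exact Measurable.ennreal_ofReal (Continuous.measurable (by fun_prop))
  have hbz : ∀ u : ℝ, ham G W P {x} (Function.update ξ x u) =
      ∑ y ∈ G.neighborFinset x, W u (ξ y) + P u := fun u => by
    rw [ham_singleton]
    simp only [Function.update_self]
    congr 1
    refine Finset.sum_congr rfl fun y hy => ?_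
    rw [SimpleGraph.mem_neighborFinset] at hy
    rw [Function.update_of_ne hy.ne']
  rw [lintegral_gibbsKer h _ _ hm, ofReal_partZ h, lmarginal_singleton, lmarginal_singleton,
    mul_comm, ← div_eq_mul_inv]
  have hnum : ∫⁻ u : ℝ, boltzmann G W P {x} (Function.update ξ x u) *
        ENNReal.ofReal (Real.exp (|Function.update ξ x u x| ^ p - 2 * B)) ≤
      ENNReal.ofReal (Real.exp (-B)) *
        ∫⁻ u : ℝ, ENNReal.ofReal (Real.exp ((1 + κ) * |u| ^ p - P u)) := by
    rw [← lintegral_const_mul _ (Measurable.ennreal_ofReal (Continuous.measurable (by fun_prop)))]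
    refine lintegral_mono fun u => ?_
    rw [boltzmann, hbz, ← ENNReal.ofReal_mul (Real.exp_pos _).le, ← Real.exp_add,
      ← ENNReal.ofReal_mul (Real.exp_pos _).le, ← Real.exp_add, Function.update_self]
    refine ENNReal.ofReal_le_ofReal (Real.exp_le_exp.mpr ?_)
    linarith [(abs_le.mp (hB u)).1]
  have hden : ENNReal.ofReal (Real.exp (-B)) *
        ∫⁻ u : ℝ, ENNReal.ofReal (Real.exp (-κ * |u| ^ p - P u)) ≤
      ∫⁻ u : ℝ, boltzmann G W P {x} (Function.update ξ x u) := by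
    rw [← lintegral_const_mul _ (Measurable.ennreal_ofReal (Continuous.measurable (by fun_prop)))]
    refine lintegral_mono fun u => ?_
    rw [boltzmann, hbz, ← ENNReal.ofReal_mul (Real.exp_pos _).le, ← Real.exp_add]
    refine ENNReal.ofReal_le_ofReal (Real.exp_le_exp.mpr ?_)
    linarith [(abs_le.mp (hB u)).2]
  refine (ENNReal.div_le_div hnum hden).trans_eq ?_
  exact ENNReal.mul_div_mul_left _ _ (by simpa using Real.exp_pos _) ENNReal.ofReal_ne_top

lemma exists_lintegral_singleton_le (h : IsStable W P IW JW r aV cV q) {p θ κ : ℝ} (hp : r < p)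
    (hpq : p < q) (hθ : r / (p - r) ≤ θ) (hκ : 0 < κ) :
    ∃ C : ℝ, 0 ≤ C ∧ ∀ (x : V) (ξ : V → ℝ),
      ∫⁻ ω, ENNReal.ofReal (|ω x| ^ p) ∂gibbsKer G W P {x} ξ ≤
        ENNReal.ofReal (C + C * mTheta G θ x) + ∑ y ∈ G.neighborFinset x,
          ENNReal.ofReal (2 * κ / (G.degree x * G.degree y)) * ENNReal.ofReal (|ξ y| ^ p) := by
  obtain ⟨C, hC, hV⟩ := exists_vertex_bound (G := G) h hp hθ hκ
  have hp0 : 0 < p := h.r_pos.trans hp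
  have hcp := continuous_abs_rpow hp0
  have hcP := h.contP
  set A : ℝ≥0∞ := (∫⁻ u : ℝ, ENNReal.ofReal (Real.exp ((1 + κ) * |u| ^ p - P u))) /
        ∫⁻ u : ℝ, ENNReal.ofReal (Real.exp (-κ * |u| ^ p - P u)) with hA
  have hAt : A ≠ ⊤ := by
    refine ENNReal.div_ne_top ?_ ?_
    · have hi := integrable_exp_abs_rpow 0 (1 + κ) cV h.r_pos h.r_lt hp0 hpq h.aV_pos
      refine ne_top_of_le_ne_top hi.lintegral_lt_top.ne (lintegral_mono fun u => ?_)
      apply ENNReal.ofReal_le_ofReal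
      apply Real.exp_le_exp.mpr
      linarith [h.boundP u]
    · refine (lintegral_pos_iff_support
        (Measurable.ennreal_ofReal (Continuous.measurable (by fun_prop)))).mpr ?_ |>.ne'
      have : (Function.support fun u : ℝ => ENNReal.ofReal (Real.exp (-κ * |u| ^ p - P u))) =
          Set.univ := by
        ext u
        simpa using Real.exp_pos _
      rw [this]; simp
  refine ⟨A.toReal + 2 * C, by positivity, fun x ξ => ?_⟩
  set S := ∑ y ∈ G.neighborFinset x, κ / (G.degree x * G.degree y) * |ξ y| ^ p with hS
  have hS0 : 0 ≤ S := Finset.sum_nonneg fun y _ => by positivity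
  have hm0 := mTheta_nonneg (G := G) θ x
  have hB : ∀ u : ℝ, |∑ y ∈ G.neighborFinset x, W u (ξ y)| ≤
      κ * |u| ^ p + (S + C * mTheta G θ x) := fun u => by
    have := hV x (Function.update ξ x u)
    have e : ∀ y ∈ G.neighborFinset x, Function.update ξ x u y = ξ y := fun y hy => by
      rw [SimpleGraph.mem_neighborFinset] at hy
      rw [Function.update_of_ne hy.ne']
    have e1 : ∑ y ∈ G.neighborFinset x, W u (Function.update ξ x u y) =
        ∑ y ∈ G.neighborFinset x, W u (ξ y) := Finset.sum_congr rfl fun y hy => by rw [e y hy]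
    have e2 : ∑ y ∈ G.neighborFinset x,
        κ / (G.degree x * G.degree y) * |Function.update ξ x u y| ^ p = S :=
      Finset.sum_congr rfl fun y hy => by rw [e y hy]
    simpa only [Function.update_self, e1, e2] using this
  have hexp := lintegral_singleton_exp_le h hB hp0
  rw [← hA] at hexp
  have := isProbabilityMeasure_gibbsKer (G := G) h {x} ξ
  have h1 : ∫⁻ ω, ENNReal.ofReal (|ω x| ^ p) ∂gibbsKer G W P {x} ξ ≤
      ENNReal.ofReal (2 * (S + C * mTheta G θ x)) + A := by
    refine le_trans ?_ (add_le_add_right hexp _)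
    calc ∫⁻ ω, ENNReal.ofReal (|ω x| ^ p) ∂gibbsKer G W P {x} ξ
        ≤ ∫⁻ ω, (ENNReal.ofReal (2 * (S + C * mTheta G θ x)) +
            ENNReal.ofReal (Real.exp (|ω x| ^ p - 2 * (S + C * mTheta G θ x))))
            ∂gibbsKer G W P {x} ξ := by
          refine lintegral_mono fun ω => ?_
          rw [← ENNReal.ofReal_add (by positivity) (Real.exp_pos _).le]
          refine ENNReal.ofReal_le_ofReal ?_
          linarith [Real.add_one_le_exp (|ω x| ^ p - 2 * (S + C * mTheta G θ x))]
      _ = _ := by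
          rw [lintegral_add_left measurable_const, lintegral_const, measure_univ, mul_one]
  refine h1.trans ?_
  have h2 : ∑ y ∈ G.neighborFinset x, ENNReal.ofReal (2 * κ / (G.degree x * G.degree y)) *
      ENNReal.ofReal (|ξ y| ^ p) = ENNReal.ofReal (2 * S) := by
    rw [hS, Finset.mul_sum, ENNReal.ofReal_sum_of_nonneg fun y _ => by positivity]
    refine Finset.sum_congr rfl fun y _ => ?_
    rw [← ENNReal.ofReal_mul (by positivity)]
    congr 1; ring
  rw [h2, ← ENNReal.ofReal_toReal hAt, ← ENNReal.ofReal_add (by positivity) (by positivity),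
    ← ENNReal.ofReal_add (by positivity) (by positivity)]
  rw [ENNReal.toReal_ofReal ENNReal.toReal_nonneg]
  refine ENNReal.ofReal_le_ofReal ?_
  nlinarith [mul_nonneg (ENNReal.toReal_nonneg : 0 ≤ A.toReal) hm0]

end OnePoint

section Moments

variable {G : SimpleGraph V} [∀ v : V, Fintype (G.neighborSet v)] {W : ℝ → ℝ → ℝ} {P : ℝ → ℝ}
  {IW JW r aV cV q : ℝ}

/-- The extended-real-valued functional `Σ_x |ω(x)|^p w_α(x)`. -/
def eNorm (G : SimpleGraph V) (o : V) (p α : ℝ) (ω : V → ℝ) : ℝ≥0∞ :=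
  ∑' x : V, ENNReal.ofReal (|ω x| ^ p * wgt G o α x)

/-- The contribution to `eNorm` of the vertices outside `Λ`. -/
def eTail (G : SimpleGraph V) (o : V) (p α : ℝ) (Λ : Finset V) (ω : V → ℝ) : ℝ≥0∞ :=
  ∑' x : V, if x ∈ Λ then 0 else ENNReal.ofReal (|ω x| ^ p * wgt G o α x)

lemma wgt_pos (o : V) (α : ℝ) (x : V) : 0 < wgt G o α x := Real.exp_pos _

lemma wgt_le_of_adj (hconn : G.Connected) (o : V) (α : ℝ) {x y : V} (hxy : G.Adj x y) :
    wgt G o α x ≤ Real.exp |α| * wgt G o α y := by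
  rw [wgt, wgt, ← Real.exp_add]
  refine Real.exp_le_exp.mpr ?_
  have h1 := SimpleGraph.dist_eq_one_iff_adj.mpr hxy
  have h2 := hconn.dist_triangle (u := o) (v := x) (w := y)
  have h3 := hconn.dist_triangle (u := o) (v := y) (w := x)
  rw [SimpleGraph.dist_comm (u := y), h1] at h3
  rw [h1] at h2
  have h2' : (G.dist o y : ℝ) ≤ G.dist o x + 1 := by exact_mod_cast h2
  have h3' : (G.dist o x : ℝ) ≤ G.dist o y + 1 := by exact_mod_cast h3
  rcases abs_cases α with ⟨h, h'⟩ | ⟨h, h'⟩ <;> rw [h] <;> nlinarith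

lemma measurable_abs_rpow_apply (p : ℝ) (x : V) :
    Measurable fun ω : V → ℝ => ENNReal.ofReal (|ω x| ^ p) := by
  fun_prop

lemma measurable_eNorm (o : V) (p α : ℝ) : Measurable (eNorm G o p α) :=
  Measurable.tsum fun x => by fun_prop

lemma measurable_eTail (o : V) (p α : ℝ) (Λ : Finset V) : Measurable (eTail G o p α Λ) :=
  Measurable.tsum fun x => by split_ifs <;> fun_prop

lemma tsum_sum_neighbor (g : V → ℝ≥0∞) :
    ∑' x, ∑ y ∈ G.neighborFinset x, g y = ∑' y, (G.degree y : ℝ≥0∞) * g y := by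
  classical
  have h1 : ∀ x, ∑ y ∈ G.neighborFinset x, g y = ∑' y, if G.Adj x y then g y else 0 := by
    intro x
    rw [tsum_eq_sum (s := G.neighborFinset x)]
    · exact Finset.sum_congr rfl fun y hy => by
        rw [if_pos ((SimpleGraph.mem_neighborFinset _ _ _).mp hy)]
    · intro y hy
      rw [SimpleGraph.mem_neighborFinset] at hy
      rw [if_neg hy]
  simp_rw [h1]
  rw [ENNReal.tsum_comm]
  refine tsum_congr fun y => ?_
  rw [tsum_eq_sum (s := G.neighborFinset y)]
  · rw [Finset.sum_congr rfl (g := fun _ => g y) fun x hx => by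
        rw [if_pos ((SimpleGraph.mem_neighborFinset _ _ _).mp hx).symm]]
    rw [Finset.sum_const, SimpleGraph.card_neighborFinset_eq_degree, nsmul_eq_mul]
  · intro x hx
    rw [SimpleGraph.mem_neighborFinset, G.adj_comm] at hx
    rw [if_neg hx]

lemma lintegral_abs_rpow_ne_top (h : IsStable W P IW JW r aV cV q) {p : ℝ} (hp : 0 < p)
    (hpq : p < q) (Λ : Finset V) (ξ : V → ℝ) {x : V} (hx : x ∈ Λ) :
    ∫⁻ ω, ENNReal.ofReal (|ω x| ^ p) ∂gibbsKer G W P Λ ξ ≠ ⊤ := by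
  rw [lintegral_gibbsKer h Λ ξ (measurable_abs_rpow_apply p x)]
  refine ENNReal.mul_ne_top (by simpa using partZ_pos h Λ ξ) ?_
  refine ne_top_of_le_ne_top (integrable_boltzmann_moment (G := G) h Λ hp hpq ξ).lintegral_lt_top.ne
    (lintegral_mono fun σ => ?_)
  change boltzmann G W P Λ (comb Λ σ ξ) * ENNReal.ofReal (|comb Λ σ ξ x| ^ p) ≤ _
  rw [boltzmann, ← ENNReal.ofReal_mul (Real.exp_pos _).le, Real.exp_add]
  refine ENNReal.ofReal_le_ofReal ?_
  gcongr
  have h1 : comb Λ σ ξ x = σ ⟨x, hx⟩ := by simp [comb, hx]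
  rw [h1]
  have h2 : |σ ⟨x, hx⟩| ^ p ≤ ∑ z, |σ z| ^ p :=
    Finset.single_le_sum (f := fun z => |σ z| ^ p) (fun z _ => by positivity) (Finset.mem_univ _)
  linarith [Real.add_one_le_exp (∑ z, |σ z| ^ p)]

lemma exists_lintegral_eNorm_le (h : IsStable W P IW JW r aV cV q) (hconn : G.Connected) (o : V)
    {p θ α : ℝ} (hp : r < p) (hpq : p < q) (hθ : r / (p - r) ≤ θ)
    (hw : Summable (wgt G o α)) (hΘ : ThetaFin G o α θ) :
    ∃ C : ℝ≥0, ∀ (Λ : Finset V) (ξ : V → ℝ),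
      ∫⁻ ω, eNorm G o p α ω ∂gibbsKer G W P Λ ξ ≤ C + 2 * eTail G o p α Λ ξ := by
  have hp0 : 0 < p := h.r_pos.trans hp
  set κ : ℝ := Real.exp (-|α|) / 4 with hκ
  have hκ0 : 0 < κ := by positivity
  have hκe : 2 * κ * Real.exp |α| = 1 / 2 := by
    rw [hκ, Real.exp_neg]; field_simp; norm_num
  obtain ⟨C, hC, hone⟩ := exists_lintegral_singleton_le (G := G) h hp hpq hθ hκ0
  set a : V → ℝ := fun x => (C + C * mTheta G θ x) * wgt G o α x with ha
  have ha0 : ∀ x, 0 ≤ a x := fun x => by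
    have := mTheta_nonneg (G := G) θ x
    have := wgt_pos (G := G) o α x
    positivity
  have hsum : Summable a := by
    have : a = fun x => C * wgt G o α x + C * (mTheta G θ x * wgt G o α x) := by
      ext x; simp only [ha]; ring
    rw [this]
    exact (hw.mul_left C).add (Summable.mul_left C hΘ)
  have haS : ∑' x, ENNReal.ofReal (a x) ≠ ⊤ := hsum.tsum_ofReal_ne_top
  refine ⟨(2 * ∑' x, ENNReal.ofReal (a x)).toNNReal, fun Λ ξ => ?_⟩
  rw [ENNReal.coe_toNNReal (ENNReal.mul_ne_top (by simp) haS)]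
  set M : V → ℝ≥0∞ := fun x => ∫⁻ ω, ENNReal.ofReal (|ω x| ^ p) ∂gibbsKer G W P Λ ξ with hM
  set w : V → ℝ≥0∞ := fun x => ENNReal.ofReal (wgt G o α x) with hwdef
  have hprob := isProbabilityMeasure_gibbsKer (G := G) h Λ ξ
  have hoff : ∀ x ∉ Λ, M x = ENNReal.ofReal (|ξ x| ^ p) := fun x hx => by
    have : M x = ∫⁻ ω, ENNReal.ofReal (|ξ x| ^ p) ∂gibbsKer G W P Λ ξ :=
      lintegral_congr_ae ((gibbsKer_ae_eq_off (G := G) h Λ ξ).mono fun ω hω => by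
        simp only [hω x hx])
    rw [this, lintegral_const, measure_univ, mul_one]
  have hF : ∫⁻ ω, eNorm G o p α ω ∂gibbsKer G W P Λ ξ = ∑' x, M x * w x := by
    simp only [eNorm]
    rw [lintegral_tsum fun x => Measurable.aemeasurable (by fun_prop)]
    refine tsum_congr fun x => ?_
    rw [hM, ← lintegral_mul_const _ (measurable_abs_rpow_apply p x)]
    refine lintegral_congr fun ω => ?_
    rw [ENNReal.ofReal_mul (by positivity)]
  rw [hF]
  rcases eq_or_ne (eTail G o p α Λ ξ) ⊤ with hT | hT
  · rw [hT]; simp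
  have hin : ∀ x ∈ Λ, M x ≤ ENNReal.ofReal (C + C * mTheta G θ x) +
      ∑ y ∈ G.neighborFinset x, ENNReal.ofReal (2 * κ / (G.degree x * G.degree y)) * M y := by
    intro x hx
    have hc := lintegral_gibbsKer_consistent (G := G) h (Finset.singleton_subset_iff.mpr hx) ξ
      (measurable_abs_rpow_apply p x)
    simp only [hM]
    rw [← hc]
    refine (lintegral_mono fun η => hone x η).trans_eq ?_
    rw [lintegral_add_left measurable_const, lintegral_const, measure_univ, mul_one,
      lintegral_finsetSum _ fun y _ => (measurable_abs_rpow_apply p y).const_mul _]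
    congr 1
    exact Finset.sum_congr rfl fun y _ => lintegral_const_mul _ (measurable_abs_rpow_apply p y)
  have hpt : ∀ x, M x * w x ≤ ENNReal.ofReal (a x) +
      (if x ∈ Λ then 0 else ENNReal.ofReal (|ξ x| ^ p * wgt G o α x)) +
      ∑ y ∈ G.neighborFinset x, ENNReal.ofReal (1 / 2 / G.degree y) * (M y * w y) := by
    intro x
    by_cases hx : x ∈ Λ
    · rw [if_pos hx, add_zero]
      refine (mul_le_mul_left (hin x hx) (w x)).trans ?_
      rw [add_mul, Finset.sum_mul]
      refine add_le_add ?_ (Finset.sum_le_sum fun y hy => ?_)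
      · have := mTheta_nonneg (G := G) θ x
        rw [hwdef, ← ENNReal.ofReal_mul (by positivity)]
      · rw [SimpleGraph.mem_neighborFinset] at hy
        rw [mul_right_comm, mul_comm (M y), ← mul_assoc]
        refine mul_le_mul_left ?_ _
        simp only [hwdef]
        rw [← ENNReal.ofReal_mul (by positivity), ← ENNReal.ofReal_mul (by positivity)]
        refine ENNReal.ofReal_le_ofReal ?_
        have hw1 := wgt_le_of_adj hconn o α hy
        have hw0 := wgt_pos (G := G) o α y
        have hx1 := one_le_degree_of_adj hy.symm
        have hy1 := one_le_degree_of_adj hy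
        have hwx := (wgt_pos (G := G) o α x).le
        calc 2 * κ / ((G.degree x : ℝ) * G.degree y) * wgt G o α x
            ≤ 2 * κ / (1 * G.degree y) * (Real.exp |α| * wgt G o α y) := by gcongr
          _ = (2 * κ * Real.exp |α|) / G.degree y * wgt G o α y := by ring
          _ = _ := by rw [hκe]
    · rw [if_neg hx, hoff x hx, hwdef, ← ENNReal.ofReal_mul (by positivity)]
      exact le_add_right le_add_self
  have hFtop : ∑' x, M x * w x ≠ ⊤ := by
    have : ∀ x, M x * w x ≤ (if x ∈ Λ then M x * w x else 0) +
        (if x ∈ Λ then 0 else ENNReal.ofReal (|ξ x| ^ p * wgt G o α x)) := fun x => by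
      by_cases hx : x ∈ Λ
      · simp [hx]
      · rw [if_neg hx, if_neg hx, hoff x hx, hwdef, ← ENNReal.ofReal_mul (by positivity), zero_add]
    refine ne_top_of_le_ne_top ?_ (ENNReal.tsum_le_tsum this)
    rw [ENNReal.tsum_add]
    refine ENNReal.add_ne_top.mpr ⟨?_, hT⟩
    rw [tsum_eq_sum (s := Λ) fun x hx => by rw [if_neg hx]]
    refine ENNReal.sum_ne_top.mpr fun x hx => ?_
    rw [if_pos hx]
    exact ENNReal.mul_ne_top (lintegral_abs_rpow_ne_top h hp0 hpq Λ ξ hx) ENNReal.ofReal_ne_top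
  have hhalf : ∑' x, M x * w x ≤ ∑' x, ENNReal.ofReal (a x) + eTail G o p α Λ ξ +
      2⁻¹ * ∑' x, M x * w x := by
    refine (ENNReal.tsum_le_tsum hpt).trans ?_
    rw [ENNReal.tsum_add, ENNReal.tsum_add, tsum_sum_neighbor, ← ENNReal.tsum_mul_left]
    refine add_le_add le_rfl (ENNReal.tsum_le_tsum fun y => ?_)
    rw [← mul_assoc]
    refine mul_le_mul_left ?_ _
    rw [← ENNReal.ofReal_natCast, ← ENNReal.ofReal_mul (by positivity)]
    have h2 : (2⁻¹ : ℝ≥0∞) = ENNReal.ofReal (1 / 2) := by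
      rw [one_div, ENNReal.ofReal_inv_of_pos (by norm_num)]; simp
    rw [h2]
    refine ENNReal.ofReal_le_ofReal ?_
    rcases eq_or_ne (G.degree y : ℝ) 0 with h0 | h0
    · rw [h0]; norm_num
    · rw [mul_div_cancel₀ _ h0]
  set F := ∑' x, M x * w x
  have e : F = 2⁻¹ * F + 2⁻¹ * F := by
    rw [← add_mul, ENNReal.inv_two_add_inv_two, one_mul]
  have h3 : 2⁻¹ * F ≤ ∑' x, ENNReal.ofReal (a x) + eTail G o p α Λ ξ := by
    have hne : 2⁻¹ * F ≠ ⊤ := ENNReal.mul_ne_top (by simp) hFtop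
    rw [← ENNReal.add_le_add_iff_right hne, ← e]
    exact hhalf
  calc F = 2 * (2⁻¹ * F) := by
        rw [← mul_assoc, ENNReal.mul_inv_cancel (by simp) (by simp), one_mul]
    _ ≤ 2 * (∑' x, ENNReal.ofReal (a x) + eTail G o p α Λ ξ) := by gcongr
    _ = _ := by rw [mul_add]

end Moments

section Tightness

variable {G : SimpleGraph V} [∀ v : V, Fintype (G.neighborSet v)] {W : ℝ → ℝ → ℝ} {P : ℝ → ℝ}
  {IW JW r aV cV q : ℝ}

lemma summable_wgt (hconn : G.Connected) (o : V) {α θ : ℝ} (hθ : 0 ≤ θ)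
    (hΘ : ThetaFin G o α θ) : Summable (wgt G o α) := by
  cases finite_or_infinite V
  · exact Summable.of_finite
  refine Summable.of_nonneg_of_le (fun x => (wgt_pos o α x).le) (fun x => ?_) hΘ
  obtain ⟨y, hy⟩ := hconn.preconnected.exists_adj_of_nontrivial x
  have hx1 := one_le_degree_of_adj hy.symm
  have hy1 := one_le_degree_of_adj hy
  have h1 : 1 ≤ mTheta G θ x := by
    refine (Real.one_le_rpow (by nlinarith : (1 : ℝ) ≤ G.degree x * G.degree y) hθ).trans ?_
    exact Finset.single_le_sum (f := fun y => ((G.degree x : ℝ) * G.degree y) ^ θ)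
      (fun y _ => by positivity) ((SimpleGraph.mem_neighborFinset _ _ _).mpr hy)
  have := wgt_pos (G := G) o α x
  exact le_mul_of_one_le_left this.le h1

lemma tendsto_eTail (o : V) {p α : ℝ} {ω : V → ℝ} (hω : eNorm G o p α ω ≠ ⊤) :
    Tendsto (fun Λ => eTail G o p α Λ ω) atTop (𝓝 0) := by
  have := ENNReal.tendsto_tsum_compl_atTop_zero hω
  refine this.congr fun Λ => ?_
  refine (tsum_subtype {x | x ∉ Λ}
    fun x => ENNReal.ofReal (|ω x| ^ p * wgt G o α x)).trans ?_
  refine tsum_congr fun x => ?_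
  by_cases hx : x ∈ Λ <;> simp [hx]

lemma eTail_anti (o : V) (p α : ℝ) (ω : V → ℝ) {Λ Λ' : Finset V} (hs : Λ ⊆ Λ') :
    eTail G o p α Λ' ω ≤ eTail G o p α Λ ω := by
  refine ENNReal.tsum_le_tsum fun x => ?_
  by_cases hx : x ∈ Λ
  · simp [hx, hs hx]
  · by_cases hx' : x ∈ Λ' <;> simp [hx, hx']

lemma measure_eNorm_le_of_lintegral_le {μ : Measure (V → ℝ)} (o : V) (p α : ℝ) {B R : ℝ≥0∞}
    (hB : ∫⁻ ω, eNorm G o p α ω ∂μ ≤ B) (hR : R ≠ 0) (hR' : R ≠ ⊤) :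
    μ {ω | R < eNorm G o p α ω} ≤ B / R :=
  calc μ {ω | R < eNorm G o p α ω} ≤ μ {ω | R ≤ eNorm G o p α ω} :=
        measure_mono fun ω (hω : R < eNorm G o p α ω) => le_of_lt hω
    _ ≤ (∫⁻ ω, eNorm G o p α ω ∂μ) / R :=
        meas_ge_le_lintegral_div (measurable_eNorm o p α).aemeasurable hR hR'
    _ ≤ B / R := ENNReal.div_le_div_right hB R

lemma IsGibbsMeasure.measure_eNorm_le (h : IsStable W P IW JW r aV cV q) (o : V) {p α : ℝ}
    {C : ℝ≥0} (hC : ∀ (Λ : Finset V) (ξ : V → ℝ),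
      ∫⁻ ω, eNorm G o p α ω ∂gibbsKer G W P Λ ξ ≤ C + 2 * eTail G o p α Λ ξ)
    {μ : Measure (V → ℝ)} (hμ : IsGibbsMeasure G W P μ)
    (hfin : ∀ᵐ ω ∂μ, eNorm G o p α ω ≠ ⊤) {R : ℝ≥0∞} (hR : R ≠ 0) (hR' : R ≠ ⊤) :
    μ {ω | R < eNorm G o p α ω} ≤ (C + 2) / R := by
  have := hμ.1
  have hbound : ∀ Λ : Finset V, μ {ω | R < eNorm G o p α ω} ≤
      (C + 2) / R + μ {ω | 1 < eTail G o p α Λ ω} := by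
    intro Λ
    have hmA : MeasurableSet {ω | R < eNorm G o p α ω} :=
      measurableSet_lt measurable_const (measurable_eNorm o p α)
    have hmT : MeasurableSet {ω | 1 < eTail G o p α Λ ω} :=
      measurableSet_lt measurable_const (measurable_eTail o p α Λ)
    rw [hμ.2 Λ _ hmA]
    calc ∫⁻ ξ, gibbsKer G W P Λ ξ {ω | R < eNorm G o p α ω} ∂μ
        ≤ ∫⁻ ξ, ((C + 2) / R + ({ω | 1 < eTail G o p α Λ ω}).indicator 1 ξ) ∂μ := by
          refine lintegral_mono fun ξ => ?_
          beta_reduce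
          have := isProbabilityMeasure_gibbsKer (G := G) h Λ ξ
          by_cases hξ : 1 < eTail G o p α Λ ξ
          · rw [Set.indicator_of_mem (s := {ω | 1 < eTail G o p α Λ ω}) hξ]
            exact prob_le_one.trans le_add_self
          · refine le_add_right ?_
            refine measure_eNorm_le_of_lintegral_le o p α ((hC Λ ξ).trans ?_) hR hR'
            gcongr
            exact mul_le_of_le_one_right' (not_lt.mp hξ)
      _ = _ := by
          rw [lintegral_add_left measurable_const, lintegral_const, measure_univ, mul_one,
            lintegral_indicator_one hmT]
  have hlim : Tendsto (fun Λ => μ {ω | 1 < eTail G o p α Λ ω}) atTop (𝓝 0) := by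
    have h0 : μ (⋂ Λ, {ω | 1 < eTail G o p α Λ ω}) = 0 := by
      refine measure_mono_null (fun ω hω => ?_) (ae_iff.mp hfin)
      intro hne
      obtain ⟨Λ, hΛ⟩ := ((tendsto_eTail o hne).eventually (gt_mem_nhds one_pos)).exists
      exact lt_asymm hΛ (Set.mem_iInter.mp hω Λ)
    rw [← h0]
    refine tendsto_measure_iInter_atTop
      (fun Λ => (measurableSet_lt measurable_const (measurable_eTail o p α Λ)).nullMeasurableSet)
      (fun Λ Λ' hs ω hω => lt_of_lt_of_le hω (eTail_anti o p α ω hs)) ⟨∅, measure_ne_top _ _⟩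
  refine ge_of_tendsto' (?_ : Tendsto (fun Λ => (C + 2) / R + μ {ω | 1 < eTail G o p α Λ ω})
    atTop (𝓝 ((C + 2) / R))) hbound
  simpa using hlim.const_add ((C + 2) / R)

lemma eTail_zero (o : V) {p : ℝ} (hp : p ≠ 0) (α : ℝ) (Λ : Finset V) :
    eTail G o p α Λ 0 = 0 := by
  simp [eTail, Real.zero_rpow hp]

end Tightness

section Tempered

variable {G : SimpleGraph V} [∀ v : V, Fintype (G.neighborSet v)]

/-- Exponents and weights cofinal in the range defining the projective limit. -/
structure IsExhausting (p0 q αlow αbar : ℝ) (pS αS : ℕ → ℝ) : Prop where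
  memp : ∀ j, pS j ∈ Set.Ico p0 q
  memα : ∀ j, αS j ∈ Set.Ioc αlow αbar
  cofinal : ∀ p < q, ∀ α > αlow, ∃ j, p ≤ pS j ∧ αS j < α

lemma exists_isExhausting {p0 q αlow αbar : ℝ} (hp : p0 < q) (hα : αlow < αbar) :
    ∃ pS αS : ℕ → ℝ, IsExhausting p0 q αlow αbar pS αS := by
  have hq : 0 < q - p0 := by linarith
  have ha : 0 < αbar - αlow := by linarith
  refine ⟨fun j => q - (q - p0) * (1 / ((j : ℝ) + 1)),
    fun j => αlow + (αbar - αlow) * (1 / ((j : ℝ) + 1)), fun j => ?_, fun j => ?_,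
    fun p hp α hα => ?_⟩
  · have h0 : 0 < 1 / ((j : ℝ) + 1) := by positivity
    have h1 : 1 / ((j : ℝ) + 1) ≤ 1 := by
      rw [div_le_one (by positivity)]; linarith [(Nat.cast_nonneg j : (0 : ℝ) ≤ j)]
    constructor <;> nlinarith
  · have h0 : 0 < 1 / ((j : ℝ) + 1) := by positivity
    have h1 : 1 / ((j : ℝ) + 1) ≤ 1 := by
      rw [div_le_one (by positivity)]; linarith [(Nat.cast_nonneg j : (0 : ℝ) ≤ j)]
    constructor <;> nlinarith
  · have ht := tendsto_one_div_add_atTop_nhds_zero_nat (𝕜 := ℝ)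
    have h1 : Tendsto (fun j : ℕ => q - (q - p0) * (1 / ((j : ℝ) + 1))) atTop (𝓝 q) := by
      simpa using (ht.const_mul (q - p0)).const_sub q
    have h2 : Tendsto (fun j : ℕ => αlow + (αbar - αlow) * (1 / ((j : ℝ) + 1))) atTop
        (𝓝 αlow) := by
      simpa using (ht.const_mul (αbar - αlow)).const_add αlow
    exact ((h1.eventually (lt_mem_nhds hp)).and (h2.eventually (gt_mem_nhds hα))).exists.imp
      fun j hj => ⟨hj.1.le, hj.2⟩

lemma term_nonneg (o : V) (p α : ℝ) (ω : V → ℝ) (x : V) : 0 ≤ |ω x| ^ p * wgt G o α x :=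
  mul_nonneg (by positivity) (wgt_pos o α x).le

lemma mem_tempered_iff (o : V) (p α : ℝ) (ω : V → ℝ) :
    ω ∈ tempered G o p α ↔ eNorm G o p α ω ≠ ⊤ := by
  refine ⟨fun hω => Summable.tsum_ofReal_ne_top hω, fun hω => ?_⟩
  refine (ENNReal.summable_toReal hω).congr fun x => ?_
  rw [ENNReal.toReal_ofReal (term_nonneg o p α ω x)]

lemma wgt_anti (o : V) {α α' : ℝ} (h : α' ≤ α) (x : V) : wgt G o α x ≤ wgt G o α' x := by
  refine Real.exp_le_exp.mpr ?_
  have : (0 : ℝ) ≤ G.dist o x := Nat.cast_nonneg _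
  nlinarith

lemma rpow_le_one_add {p p' t : ℝ} (ht : 0 ≤ t) (hp0 : 0 ≤ p) (hp : p ≤ p') :
    t ^ p ≤ 1 + t ^ p' := by
  rcases le_total t 1 with h | h
  · have := Real.rpow_le_one ht h hp0
    have := Real.rpow_nonneg ht p'
    linarith
  · have := Real.rpow_le_rpow_of_exponent_le h hp
    linarith

lemma eNorm_le (o : V) {p p' α α' : ℝ} (hp0 : 0 ≤ p) (hp : p ≤ p') (hα : α' ≤ α)
    (ω : V → ℝ) :
    eNorm G o p α ω ≤ ∑' x, ENNReal.ofReal (wgt G o α' x) + eNorm G o p' α' ω := by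
  rw [eNorm, eNorm, ← ENNReal.tsum_add]
  refine ENNReal.tsum_le_tsum fun x => ?_
  have hw := wgt_pos (G := G) o α' x
  rw [← ENNReal.ofReal_add hw.le (term_nonneg o p' α' ω x)]
  refine ENNReal.ofReal_le_ofReal ?_
  calc |ω x| ^ p * wgt G o α x ≤ (1 + |ω x| ^ p') * wgt G o α' x := by
        gcongr
        · exact (wgt_pos o α x).le
        · exact rpow_le_one_add (abs_nonneg _) hp0 hp
        · exact wgt_anti o hα x
    _ = _ := by ring

/-- Configurations whose norms along the sequences `pS`, `αS` are bounded by `R`. -/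
def bddConfig (G : SimpleGraph V) (o : V) (pS αS : ℕ → ℝ) (R : ℕ → ℝ≥0∞) : Set (V → ℝ) :=
  {ω | ∀ j, eNorm G o (pS j) (αS j) ω ≤ R j}

variable {p0 q αlow αbar : ℝ} {pS αS : ℕ → ℝ} {o : V}

lemma iInter_tempered_eq (hc : IsExhausting p0 q αlow αbar pS αS) (hp0 : 0 < p0)
    (hw : ∀ α ∈ Set.Ioc αlow αbar, Summable (wgt G o α)) :
    (⋂ p ∈ Set.Ico p0 q, ⋂ α ∈ Set.Ioc αlow αbar, tempered G o p α) =
      {ω | ∀ j, eNorm G o (pS j) (αS j) ω ≠ ⊤} := by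
  ext ω
  simp only [Set.mem_iInter, Set.mem_ofPred_eq, mem_tempered_iff]
  refine ⟨fun hω j => hω _ (hc.memp j) _ (hc.memα j), fun hω p hp α hα => ?_⟩
  obtain ⟨j, hj, hj'⟩ := hc.cofinal p hp.2 α hα.1
  refine ne_top_of_le_ne_top ?_ (eNorm_le o (hp0.le.trans hp.1) hj hj'.le ω)
  exact ENNReal.add_ne_top.mpr ⟨(hw _ (hc.memα j)).tsum_ofReal_ne_top, hω j⟩

lemma lowerSemicontinuous_eNorm {p : ℝ} (hp : 0 < p) (α : ℝ) :
    LowerSemicontinuous (eNorm G o p α) := by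
  refine lowerSemicontinuous_tsum fun x => Continuous.lowerSemicontinuous ?_
  have : Continuous fun ω : V → ℝ => |ω x| ^ p :=
    (continuous_abs_rpow hp).comp (continuous_apply x)
  exact ENNReal.continuous_ofReal.comp (this.mul continuous_const)

lemma isCompact_bddConfig (hc : IsExhausting p0 q αlow αbar pS αS) (hp0 : 0 < p0)
    {R : ℕ → ℝ≥0∞} (hR : ∀ j, R j ≠ ⊤) : IsCompact (bddConfig G o pS αS R) := by
  have hpos : ∀ j, 0 < pS j := fun j => hp0.trans_le (hc.memp j).1
  have hclosed : IsClosed (bddConfig G o pS αS R) := by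
    rw [bddConfig, Set.ofPred_forall]
    exact isClosed_iInter fun j => (lowerSemicontinuous_eNorm (hpos j) (αS j)).isClosed_preimage _
  let b : V → ℝ := fun x => ((R 0).toReal / wgt G o (αS 0) x) ^ (pS 0)⁻¹
  refine (isCompact_univ_pi fun x => isCompact_Icc (a := -b x) (b := b x)).of_isClosed_subset
    hclosed fun ω hω x _ => ?_
  refine abs_le.mp ?_
  have h1 : ENNReal.ofReal (|ω x| ^ pS 0 * wgt G o (αS 0) x) ≤ R 0 :=
    (ENNReal.le_tsum x).trans (hω 0)
  have h2 := (ENNReal.ofReal_le_iff_le_toReal (hR 0)).mp h1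
  rw [← le_div_iff₀ (wgt_pos _ _ _)] at h2
  exact (Real.le_rpow_inv_iff_of_pos (abs_nonneg _)
    (div_nonneg ENNReal.toReal_nonneg (wgt_pos _ _ _).le) (hpos 0)).mpr h2

lemma tendsto_wgt_cofinite {γ β : ℝ} (hγ : Summable (wgt G o γ)) (hβ : 0 < β) :
    Tendsto (wgt G o β) cofinite (𝓝 0) := by
  have h1 := Real.tendsto_exp_comp_nhds_zero.mp hγ.tendsto_cofinite_zero
  have h2 : Tendsto (fun x => β * ((|γ| + 1)⁻¹ * ((|γ| + 1) * (G.dist o x : ℝ)))) cofinite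
      atTop := by
    refine Tendsto.const_mul_atTop hβ (Tendsto.const_mul_atTop (by positivity) ?_)
    refine tendsto_atTop_mono (fun x => ?_) (tendsto_neg_atBot_atTop.comp h1)
    have : (0 : ℝ) ≤ G.dist o x := Nat.cast_nonneg _
    simp only [Function.comp]
    nlinarith [le_abs_self γ]
  refine Real.tendsto_exp_comp_nhds_zero.mpr ((tendsto_neg_atTop_atBot.comp h2).congr fun x => ?_)
  simp only [Function.comp]
  have : |γ| + 1 ≠ 0 := by positivity
  field_simp

lemma abs_sub_rpow_le {p : ℝ} (hp : 0 ≤ p) (a b : ℝ) :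
    |a - b| ^ p ≤ 2 ^ p * (|a| ^ p + |b| ^ p) := by
  have h1 : |a - b| ≤ 2 * max |a| |b| := by
    refine (abs_sub a b).trans ?_
    linarith [le_max_left |a| |b|, le_max_right |a| |b|]
  calc |a - b| ^ p ≤ (2 * max |a| |b|) ^ p := by gcongr
    _ = 2 ^ p * (max |a| |b|) ^ p := Real.mul_rpow (by norm_num) (by positivity)
    _ ≤ _ := by
        gcongr
        have ha : 0 ≤ |a| ^ p := by positivity
        have hb : 0 ≤ |b| ^ p := by positivity
        rcases max_cases |a| |b| with ⟨h, _⟩ | ⟨h, _⟩ <;> rw [h] <;> linarith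

lemma continuousOn_norm_sub (hc : IsExhausting p0 q αlow αbar pS αS) (hp0 : 0 < p0)
    (hw : ∀ α ∈ Set.Ioc αlow αbar, Summable (wgt G o α)) {R : ℕ → ℝ≥0∞} (hR : ∀ j, R j ≠ ⊤)
    {p α : ℝ} (hp : p ∈ Set.Ico p0 q) (hα : α ∈ Set.Ioc αlow αbar) {η : V → ℝ}
    (hη : ∀ j, eNorm G o (pS j) (αS j) η ≠ ⊤) :
    ContinuousOn (fun ω : V → ℝ => ∑' x, |ω x - η x| ^ p * wgt G o α x)
      (bddConfig G o pS αS R) := by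
  have hpp : 0 < p := hp0.trans_le hp.1
  obtain ⟨j, hj, hj'⟩ := hc.cofinal p hp.2 α hα.1
  obtain ⟨α', hα'⟩ : ∃ α', α' = αS j := ⟨_, rfl⟩
  have hwα' : Summable (wgt G o α') := hα' ▸ hw _ (hc.memα j)
  obtain ⟨L, hL⟩ : ∃ L, L = ∑' x, ENNReal.ofReal (wgt G o α' x) := ⟨_, rfl⟩
  have hLt : L ≠ ⊤ := hL ▸ hwα'.tsum_ofReal_ne_top
  have hbound : ∀ ω : V → ℝ, eNorm G o p α' ω ≤ L + eNorm G o (pS j) (αS j) ω := fun ω => by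
    rw [hL, hα']; exact eNorm_le o hpp.le hj le_rfl ω
  have hηt : eNorm G o p α' η ≠ ⊤ :=
    ne_top_of_le_ne_top (ENNReal.add_ne_top.mpr ⟨hLt, hη j⟩) (hbound η)
  have hD : L + R j ≠ ⊤ := ENNReal.add_ne_top.mpr ⟨hLt, hR j⟩
  obtain ⟨D, hDdef⟩ : ∃ D, D = 2 ^ p * ((L + R j).toReal + (eNorm G o p α' η).toReal) := ⟨_, rfl⟩
  have hD0 : 0 ≤ D := by rw [hDdef]; positivity
  have hterm : ∀ ω ∈ bddConfig G o pS αS R, Summable (fun x => |ω x| ^ p * wgt G o α' x) ∧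
      ∑' x, |ω x| ^ p * wgt G o α' x ≤ (L + R j).toReal := fun ω hω => by
    have h1 : eNorm G o p α' ω ≤ L + R j := (hbound ω).trans (add_le_add le_rfl (hω j))
    have h2 := ne_top_of_le_ne_top hD h1
    have h3 := (mem_tempered_iff o p α' ω).mpr h2
    refine ⟨h3, ?_⟩
    have := ENNReal.toReal_mono hD h1
    rwa [eNorm, ← ENNReal.ofReal_tsum_of_nonneg (term_nonneg o p α' ω) h3,
      ENNReal.toReal_ofReal (tsum_nonneg (term_nonneg o p α' ω))] at this
  have hηs := (mem_tempered_iff o p α' η).mpr hηt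
  have hηe : ∑' x, |η x| ^ p * wgt G o α' x = (eNorm G o p α' η).toReal := by
    rw [eNorm, ← ENNReal.ofReal_tsum_of_nonneg (term_nonneg o p α' η) hηs,
      ENNReal.toReal_ofReal (tsum_nonneg (term_nonneg o p α' η))]
  refine continuousOn_of_uniform_approx_of_continuousOn fun u hu => ?_
  obtain ⟨ε, hε, hεu⟩ := Metric.mem_uniformity_dist.mp hu
  have hδ : 0 < ε / (D + 1) := by positivity
  have hfin : {x | ¬ wgt G o (α - α') x < ε / (D + 1)}.Finite :=
    (tendsto_wgt_cofinite hwα' (by rw [hα']; linarith : 0 < α - α')).eventually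
      (gt_mem_nhds hδ)
  refine ⟨fun ω => ∑ x ∈ hfin.toFinset, |ω x - η x| ^ p * wgt G o α x, ?_, fun ω hω => hεu ?_⟩
  · refine Continuous.continuousOn (continuous_finsetSum _ fun x _ => Continuous.mul ?_
      continuous_const)
    exact (continuous_abs_rpow hpp).comp ((continuous_apply x).sub continuous_const)
  obtain ⟨hs, hsle⟩ := hterm ω hω
  have hmul : ∀ x, wgt G o α x = wgt G o (α - α') x * wgt G o α' x := fun x => by
    rw [wgt, wgt, wgt, ← Real.exp_add]; congr 1; ring
  have hgs : Summable fun x => 2 ^ p * (|ω x| ^ p * wgt G o α' x + |η x| ^ p * wgt G o α' x) :=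
    (hs.add hηs).mul_left _
  have hgle : ∑' x, 2 ^ p * (|ω x| ^ p * wgt G o α' x + |η x| ^ p * wgt G o α' x) ≤ D := by
    rw [tsum_mul_left, hs.tsum_add hηs, hηe, hDdef]
    gcongr
  have hle : ∀ x, |ω x - η x| ^ p * wgt G o α x ≤
      wgt G o (α - α') x * (2 ^ p * (|ω x| ^ p * wgt G o α' x + |η x| ^ p * wgt G o α' x)) :=
    fun x => by
    rw [hmul]
    have := abs_sub_rpow_le hpp.le (ω x) (η x)
    have h1 := wgt_pos (G := G) o (α - α') x
    have h2 := wgt_pos (G := G) o α' x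
    calc |ω x - η x| ^ p * (wgt G o (α - α') x * wgt G o α' x)
        ≤ (2 ^ p * (|ω x| ^ p + |η x| ^ p)) * (wgt G o (α - α') x * wgt G o α' x) := by gcongr
      _ = _ := by ring
  have hg0 : ∀ x, 0 ≤ 2 ^ p * (|ω x| ^ p * wgt G o α' x + |η x| ^ p * wgt G o α' x) := fun x =>
    mul_nonneg (by positivity) (add_nonneg (term_nonneg o p α' ω x) (term_nonneg o p α' η x))
  have hf0 : ∀ x, 0 ≤ |ω x - η x| ^ p * wgt G o α x := fun x =>
    mul_nonneg (by positivity) (wgt_pos o α x).le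
  have hwle : ∀ x, wgt G o (α - α') x ≤ 1 := fun x => by
    rw [wgt, Real.exp_le_one_iff]
    have : (0 : ℝ) ≤ G.dist o x := Nat.cast_nonneg _
    have : 0 < α - α' := by rw [hα']; linarith
    nlinarith
  have hfs : Summable fun x => |ω x - η x| ^ p * wgt G o α x :=
    hgs.of_nonneg_of_le hf0 fun x => (hle x).trans (mul_le_of_le_one_left (hg0 x) (hwle x))
  rw [Real.dist_eq, ← hfs.sum_add_tsum_compl (s := hfin.toFinset), add_sub_cancel_left,
    abs_of_nonneg (tsum_nonneg fun x => hf0 _)]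
  calc ∑' x : ↑((hfin.toFinset : Set V)ᶜ), |ω x - η x| ^ p * wgt G o α x
      ≤ ∑' x : ↑((hfin.toFinset : Set V)ᶜ), ε / (D + 1) *
          (2 ^ p * (|ω x| ^ p * wgt G o α' x + |η x| ^ p * wgt G o α' x)) := by
        refine Summable.tsum_le_tsum (fun x => (hle x).trans ?_) (hfs.subtype _)
          ((hgs.subtype _).mul_left _)
        have hx : wgt G o (α - α') x < ε / (D + 1) := by
          have := x.2
          simpa only [Set.Finite.coe_toFinset, Set.mem_compl_iff, Set.mem_ofPred_eq, not_not]
            using this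
        exact mul_le_mul_of_nonneg_right hx.le (hg0 x)
    _ ≤ ε / (D + 1) * D := by
        rw [tsum_mul_left]
        gcongr
        exact (Summable.tsum_subtype_le _ _ hg0 hgs).trans hgle
    _ < ε := by
        rw [div_mul_eq_mul_div, div_lt_iff₀ (by positivity)]
        nlinarith

end Tempered

section Compactness

variable {G : SimpleGraph V} [∀ v : V, Fintype (G.neighborSet v)] {W : ℝ → ℝ → ℝ} {P : ℝ → ℝ}
  {IW JW r aV cV q : ℝ}

/-- The local Gibbs specification as a Markov kernel. -/
def gibbsKernel (h : IsStable W P IW JW r aV cV q) (Λ : Finset V) :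
    ProbabilityTheory.Kernel (V → ℝ) (V → ℝ) :=
  ⟨gibbsKer G W P Λ, measurable_gibbsKer h Λ⟩

instance isMarkovKernel_gibbsKernel (h : IsStable W P IW JW r aV cV q) (Λ : Finset V) :
    ProbabilityTheory.IsMarkovKernel (gibbsKernel (G := G) h Λ) :=
  ⟨isProbabilityMeasure_gibbsKer h Λ⟩

lemma isGibbsMeasure_iff_bind (h : IsStable W P IW JW r aV cV q) (μ : ProbabilityMeasure (V → ℝ)) :
    IsGibbsMeasure G W P μ ↔
      ∀ Λ : Finset V, (μ : Measure (V → ℝ)).bind (gibbsKernel (G := G) h Λ) = μ := by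
  refine ⟨fun hμ Λ => ?_, fun hμ => ⟨inferInstance, fun Λ A hA => ?_⟩⟩
  · ext A hA
    rw [Measure.bind_apply hA (gibbsKernel (G := G) h Λ).measurable.aemeasurable, hμ.2 Λ A hA]
    rfl
  · conv_lhs => rw [← hμ Λ]
    rw [Measure.bind_apply hA (gibbsKernel (G := G) h Λ).measurable.aemeasurable]
    rfl

/-- The Feller action of the local Gibbs specification on bounded continuous functions. -/
def gibbsAction (h : IsStable W P IW JW r aV cV q) (Λ : Finset V)
    (f : BoundedContinuousFunction (V → ℝ) ℝ) : BoundedContinuousFunction (V → ℝ) ℝ :=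
  BoundedContinuousFunction.ofNormedAddCommGroup (fun ξ => ∫ ω, f ω ∂gibbsKer G W P Λ ξ)
    (continuous_integral_gibbsKer h Λ f) ‖f‖ fun ξ => by
      have := isProbabilityMeasure_gibbsKer (G := G) h Λ ξ
      simpa using norm_integral_le_of_norm_le_const (μ := gibbsKer G W P Λ ξ)
        (ae_of_all _ f.norm_coe_le_norm)

lemma bind_gibbsKernel_eq_iff (h : IsStable W P IW JW r aV cV q)
    (μ : ProbabilityMeasure (V → ℝ)) (Λ : Finset V) :
    (μ : Measure (V → ℝ)).bind (gibbsKernel (G := G) h Λ) = μ ↔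
      ∀ f : BoundedContinuousFunction (V → ℝ) ℝ,
        ∫ ω, f ω ∂(μ : Measure (V → ℝ)) = ∫ ω, gibbsAction (G := G) h Λ f ω ∂(μ : Measure _) := by
  have key : ∀ f : BoundedContinuousFunction (V → ℝ) ℝ,
      ∫ ω, f ω ∂((μ : Measure (V → ℝ)).bind (gibbsKernel (G := G) h Λ)) =
        ∫ ω, gibbsAction (G := G) h Λ f ω ∂(μ : Measure _) := fun f => by
    rw [Measure.comp_eq_comp_const_apply, ProbabilityTheory.Kernel.integral_comp (f.integrable _),
      ProbabilityTheory.Kernel.const_apply]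
    rfl
  refine ⟨fun hμ f => ?_, fun hμ => ext_of_forall_integral_eq_of_IsFiniteMeasure fun f => ?_⟩
  · rw [← key f, hμ]
  · rw [hμ f, key f]

lemma isClosed_bind_gibbsKernel_eq (h : IsStable W P IW JW r aV cV q) (Λ : Finset V) :
    IsClosed {μ : ProbabilityMeasure (V → ℝ) |
      (μ : Measure (V → ℝ)).bind (gibbsKernel (G := G) h Λ) = μ} := by
  simp only [bind_gibbsKernel_eq_iff, Set.ofPred_forall]
  exact isClosed_iInter fun f =>
    isClosed_eq (ProbabilityMeasure.continuous_integral_boundedContinuousFunction _)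
      (ProbabilityMeasure.continuous_integral_boundedContinuousFunction _)

lemma bind_gibbsKernel_gibbsKer (h : IsStable W P IW JW r aV cV q) {Δ Λ : Finset V} (hs : Δ ⊆ Λ)
    (ξ : V → ℝ) :
    (gibbsKer G W P Λ ξ).bind (gibbsKernel (G := G) h Δ) = gibbsKer G W P Λ ξ := by
  ext A hA
  rw [Measure.bind_apply hA (gibbsKernel (G := G) h Δ).measurable.aemeasurable]
  have := lintegral_gibbsKer_consistent (G := G) h hs ξ (measurable_one.indicator hA)
  simp only [lintegral_indicator_one hA] at this
  exact this

/-- The Gibbs measures within a compact set of laws controlling all finite-volume laws with zero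
boundary condition form a non-empty compact set. -/
lemma isCompact_inter_isGibbsMeasure (h : IsStable W P IW JW r aV cV q)
    {T : Set (ProbabilityMeasure (V → ℝ))} (hT : IsCompact T)
    (h0 : ∀ Λ : Finset V, ∃ μ ∈ T, (μ : Measure (V → ℝ)) = gibbsKer G W P Λ 0) :
    (T ∩ {μ | IsGibbsMeasure G W P (μ : Measure (V → ℝ))}).Nonempty ∧
      IsCompact (T ∩ {μ | IsGibbsMeasure G W P (μ : Measure (V → ℝ))}) := by
  have heq : {μ : ProbabilityMeasure (V → ℝ) | IsGibbsMeasure G W P (μ : Measure (V → ℝ))} =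
      ⋂ Λ : Finset V, {μ : ProbabilityMeasure (V → ℝ) |
        (μ : Measure (V → ℝ)).bind (gibbsKernel (G := G) h Λ) = μ} := by
    ext μ
    simp only [Set.mem_iInter, Set.mem_ofPred_eq, isGibbsMeasure_iff_bind h]
  rw [heq]
  refine ⟨hT.inter_iInter_nonempty _ (isClosed_bind_gibbsKernel_eq h) fun u => ?_,
    hT.inter_right (isClosed_iInter (isClosed_bind_gibbsKernel_eq h))⟩
  obtain ⟨μ, hμT, hμ⟩ := h0 (u.sup id)
  refine ⟨μ, hμT, Set.mem_iInter₂.mpr fun Δ hΔ => ?_⟩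
  simp only [Set.mem_ofPred_eq, hμ]
  exact bind_gibbsKernel_gibbsKer h (Finset.le_sup (f := id) hΔ) 0

variable {p0 αlow αbar : ℝ} {pS αS : ℕ → ℝ} {o : V}

/-- Levels making the union bound over the norms summable to `2⁻¹ ^ n`. -/
def level (D : ℕ → ℝ≥0) (n j : ℕ) : ℝ≥0∞ := (D j + 2) * 2 ^ (n + 1 + j)

lemma level_ne_top (D : ℕ → ℝ≥0) (n j : ℕ) : level D n j ≠ ⊤ := by
  unfold level; finiteness

lemma level_ne_zero (D : ℕ → ℝ≥0) (n j : ℕ) : level D n j ≠ 0 := by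
  simp [level]

lemma measure_compl_bddConfig_le {μ : Measure (V → ℝ)} {D : ℕ → ℝ≥0}
    (hμ : ∀ j, ∀ R : ℝ≥0∞, R ≠ 0 → R ≠ ⊤ →
      μ {ω | R < eNorm G o (pS j) (αS j) ω} ≤ (D j + 2) / R) (n : ℕ) :
    μ (bddConfig G o pS αS (level D n))ᶜ ≤ 2⁻¹ ^ n := by
  have h1 : (bddConfig G o pS αS (level D n))ᶜ =
      ⋃ j, {ω | level D n j < eNorm G o (pS j) (αS j) ω} := by
    ext ω
    simp [bddConfig]
  rw [h1]
  refine (measure_iUnion_le _).trans ?_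
  calc ∑' j, μ {ω | level D n j < eNorm G o (pS j) (αS j) ω}
      ≤ ∑' j : ℕ, (2⁻¹ : ℝ≥0∞) ^ (n + 1) * 2⁻¹ ^ j := by
        refine ENNReal.tsum_le_tsum fun j => (hμ j _ (level_ne_zero D n j)
          (level_ne_top D n j)).trans_eq ?_
        rw [level, ← pow_add, div_eq_mul_inv, ENNReal.mul_inv (by simp) (by simp), ← mul_assoc,
          ENNReal.mul_inv_cancel (by simp) (by finiteness), one_mul, ENNReal.inv_pow]
    _ = 2⁻¹ ^ n := by
        rw [ENNReal.tsum_mul_left, ENNReal.tsum_geometric, ENNReal.one_sub_inv_two, inv_inv,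
          pow_succ, mul_assoc, ENNReal.inv_mul_cancel (by simp) (by simp), mul_one]

/-- The laws giving mass at least `1 - 2⁻¹ ^ n` to the `n`-th compact set of configurations. -/
def tightSet (G : SimpleGraph V) (o : V) (pS αS : ℕ → ℝ) (D : ℕ → ℝ≥0) :
    Set (ProbabilityMeasure (V → ℝ)) :=
  {μ | ∀ n, μ (bddConfig G o pS αS (level D n))ᶜ ≤ (2⁻¹ : ℝ≥0) ^ n}

lemma mem_tightSet_of_forall {μ : ProbabilityMeasure (V → ℝ)} {D : ℕ → ℝ≥0}
    (hμ : ∀ j, ∀ R : ℝ≥0∞, R ≠ 0 → R ≠ ⊤ →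
      (μ : Measure (V → ℝ)) {ω | R < eNorm G o (pS j) (αS j) ω} ≤ (D j + 2) / R) :
    μ ∈ tightSet G o pS αS D := fun n => by
  have := measure_compl_bddConfig_le hμ n
  rw [← ENNReal.coe_le_coe, ProbabilityMeasure.ennreal_coeFn_eq_coeFn_toMeasure]
  refine this.trans_eq ?_
  rw [ENNReal.coe_pow, ENNReal.coe_inv two_ne_zero, ENNReal.coe_ofNat]

lemma isCompact_tightSet (hc : IsExhausting p0 q αlow αbar pS αS) (hp0 : 0 < p0) (D : ℕ → ℝ≥0) :
    IsCompact (tightSet G o pS αS D) := by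
  refine isCompact_setOfPred_probabilityMeasure_mass_eq_compl_isCompact_le ?_
    (fun n => isCompact_bddConfig hc hp0 (level_ne_top D n)) (Or.inl inferInstance)
  exact tendsto_pow_atTop_nhds_zero_of_lt_one (by simp) (by
    rw [← NNReal.coe_lt_coe]; norm_num)

end Compactness

section WeakTopology

lemma measure_compl_iUnion_eq_zero {X : Type*} [MeasurableSpace X] {K : ℕ → Set X}
    {μ : ProbabilityMeasure X} (hμ : ∀ n, μ (K n)ᶜ ≤ (2⁻¹ : ℝ≥0) ^ n) :
    (μ : Measure X) (⋃ n, K n)ᶜ = 0 := by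
  have hlim : Tendsto (fun n : ℕ => (2⁻¹ : ℝ≥0) ^ n) atTop (𝓝 0) :=
    tendsto_pow_atTop_nhds_zero_of_lt_one (by simp) (by
      rw [← NNReal.coe_lt_coe]; norm_num)
  rw [← ProbabilityMeasure.ennreal_coeFn_eq_coeFn_toMeasure, ENNReal.coe_eq_zero]
  exact le_antisymm (ge_of_tendsto' hlim fun n => (ProbabilityMeasure.apply_mono μ
    (Set.compl_subset_compl.mpr (Set.subset_iUnion K n))).trans (hμ n)) zero_le

lemma continuousOn_integral_of_forall_continuousOn {X : Type*} [TopologicalSpace X]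
    [NormalSpace X] [MeasurableSpace X] [BorelSpace X] {K : ℕ → Set X} (hK : ∀ n, IsClosed (K n))
    {T : Set (ProbabilityMeasure X)} (hT : ∀ μ ∈ T, ∀ n, μ (K n)ᶜ ≤ (2⁻¹ : ℝ≥0) ^ n)
    {f : X → ℝ} {M : ℝ} (hM : ∀ x, |f x| ≤ M) (hf : ∀ n, ContinuousOn f (K n)) :
    ContinuousOn (fun μ : ProbabilityMeasure X => ∫ x, f x ∂(μ : Measure X)) T := by
  rcases isEmpty_or_nonempty X with hX | ⟨⟨x₀⟩⟩
  · simpa [integral_of_isEmpty] using continuousOn_const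
  have hM0 : 0 ≤ M := (abs_nonneg _).trans (hM x₀)
  have hreal : ∀ μ ∈ T, ∀ n, (μ : Measure X).real (K n)ᶜ ≤ 2⁻¹ ^ n := fun μ hμ n => by
    exact_mod_cast hT μ hμ n
  have h_integral : ∀ μ ∈ T, Integrable f (μ : Measure X) := fun μ hμ => by
    refine Integrable.of_bound (C := M) ?_ (ae_of_all _ hM)
    rw [← Measure.restrict_eq_self_of_ae_mem (s := ⋃ n, K n) (mem_ae_iff.mpr
      (measure_compl_iUnion_eq_zero (hT μ hμ))), aestronglyMeasurable_iUnion_iff]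
    exact fun n => (hf n).aestronglyMeasurable (hK n).measurableSet
  have hext : ∀ n, ∃ g : BoundedContinuousFunction X ℝ, (∀ x, g x ∈ Set.Icc (-M) M) ∧
      ∀ x ∈ K n, g x = f x := fun n => by
    let e : BoundedContinuousFunction (K n) ℝ :=
      BoundedContinuousFunction.ofNormedAddCommGroup ((K n).domRestrict f) (hf n).domRestrict M
        fun x => hM x
    obtain ⟨g, hg, hgf⟩ := e.exists_extension_forall_mem_of_isClosedEmbedding
      (t := Set.Icc (-M) M) (fun x => abs_le.mp (hM x)) ⟨0, by simpa using hM0⟩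
      (hK n).isClosedEmbedding_subtypeVal
    exact ⟨g, hg, fun x hx => congrFun hgf ⟨x, hx⟩⟩
  choose g hg hgf using hext
  refine continuousOn_of_uniform_approx_of_continuousOn fun u hu => ?_
  obtain ⟨ε, hε, hεu⟩ := Metric.mem_uniformity_dist.mp hu
  have hlim : Tendsto (fun n : ℕ => 2 * M * (2⁻¹ : ℝ) ^ n) atTop (𝓝 0) := by
    simpa using (tendsto_pow_atTop_nhds_zero_of_lt_one (r := (2⁻¹ : ℝ)) (by norm_num)
      (by norm_num)).const_mul (2 * M)
  obtain ⟨n, hn⟩ := (hlim.eventually (gt_mem_nhds hε)).exists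
  refine ⟨fun μ => ∫ x, g n x ∂(μ : Measure X),
    (ProbabilityMeasure.continuous_integral_boundedContinuousFunction (g n)).continuousOn,
    fun μ hμ => hεu ?_⟩
  have hKm : MeasurableSet (K n)ᶜ := (hK n).measurableSet.compl
  rw [Real.dist_eq, ← integral_sub (h_integral μ hμ) ((g n).integrable _)]
  calc |∫ x, (f x - g n x) ∂(μ : Measure X)|
      ≤ ∫ x, (K n)ᶜ.indicator (fun _ => 2 * M) x ∂(μ : Measure X) := by
        rw [← Real.norm_eq_abs]
        refine norm_integral_le_of_norm_le ((integrable_const _).indicator hKm)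
          (ae_of_all _ fun x => ?_)
        by_cases hx : x ∈ K n
        · simp [hx, hgf n x hx]
        · rw [Set.indicator_of_mem hx, Real.norm_eq_abs]
          have h1 := abs_le.mp (hM x)
          have h2 := hg n x
          exact abs_le.mpr ⟨by linarith [h1.1, h2.2], by linarith [h1.2, h2.1]⟩
    _ = 2 * M * (μ : Measure X).real (K n)ᶜ := by
        rw [integral_indicator_const _ hKm, smul_eq_mul, mul_comm]
    _ ≤ 2 * M * 2⁻¹ ^ n := by gcongr; exact hreal μ hμ n
    _ < ε := hn

lemma ContinuousOn.weakTop {Y : Type*} [TopologicalSpace Y] {X : Type} [MeasurableSpace X]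
    {tX : TopologicalSpace X} {Φ : Y → Measure X} {T : Set Y}
    (h : ∀ f : X → ℝ, Continuous f → (∃ M, ∀ x, |f x| ≤ M) →
      ContinuousOn (fun y => ∫ x, f x ∂Φ y) T) :
    @ContinuousOn Y (Measure X) _ (weakTop X tX) Φ T := by
  let := _root_.weakTop X tX
  rw [continuousOn_iff_continuous_domRestrict]
  refine continuous_iInf_rng.mpr fun f => continuous_iInf_rng.mpr fun hf =>
    continuous_iInf_rng.mpr fun hM => continuous_induced_rng.mpr ?_
  exact (h f hf hM).domRestrict

variable {G : SimpleGraph V} [∀ v : V, Fintype (G.neighborSet v)] {p0 q αlow αbar : ℝ}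
  {pS αS : ℕ → ℝ} {o : V}

lemma continuous_inclusion_bddConfig (hc : IsExhausting p0 q αlow αbar pS αS) (hp0 : 0 < p0)
    (hw : ∀ α ∈ Set.Ioc αlow αbar, Summable (wgt G o α)) {R : ℕ → ℝ≥0∞} (hR : ∀ j, R j ≠ ⊤)
    {Ωt : Set (V → ℝ)} (hΩ : Ωt = {ω | ∀ j, eNorm G o (pS j) (αS j) ω ≠ ⊤})
    (hs : bddConfig G o pS αS R ⊆ Ωt) :
    @Continuous _ _ _ (projTop G o p0 q αlow αbar Ωt) (Set.inclusion hs) := by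
  let := projTop G o p0 q αlow αbar Ωt
  refine continuous_iInf_rng.mpr fun p => continuous_iInf_rng.mpr fun hp =>
    continuous_iInf_rng.mpr fun α => continuous_iInf_rng.mpr fun hα =>
    continuous_iInf_rng.mpr fun η => continuous_induced_rng.mpr ?_
  have hη : ∀ j, eNorm G o (pS j) (αS j) η ≠ ⊤ := hΩ.subset η.2
  refine Continuous.rpow_const
    (continuousOn_norm_sub hc hp0 hw hR hp hα hη).domRestrict fun _ => Or.inr ?_
  have := hp0.trans_le hp.1
  positivity

lemma bddConfig_level_subset {Ωt : Set (V → ℝ)}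
    (hΩ : Ωt = {ω | ∀ j, eNorm G o (pS j) (αS j) ω ≠ ⊤}) (D : ℕ → ℝ≥0) (n : ℕ) :
    bddConfig G o pS αS (level D n) ⊆ Ωt := fun ω hω => by
  rw [hΩ]
  exact fun j => ne_top_of_le_ne_top (level_ne_top D n j) (hω j)

lemma continuousOn_comap_val (hc : IsExhausting p0 q αlow αbar pS αS) (hp0 : 0 < p0)
    (hw : ∀ α ∈ Set.Ioc αlow αbar, Summable (wgt G o α))
    {Ωt : Set (V → ℝ)} (hΩ : Ωt = {ω | ∀ j, eNorm G o (pS j) (αS j) ω ≠ ⊤})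
    (hΩm : MeasurableSet Ωt) (D : ℕ → ℝ≥0) :
    @ContinuousOn _ _ _ (weakTop ↥Ωt (projTop G o p0 q αlow αbar Ωt))
      (fun μ : ProbabilityMeasure (V → ℝ) =>
        (μ : Measure (V → ℝ)).comap (Subtype.val : ↥Ωt → V → ℝ)) (tightSet G o pS αS D) := by
  classical
  have hs := bddConfig_level_subset (G := G) (o := o) hΩ D
  let := projTop G o p0 q αlow αbar Ωt
  refine ContinuousOn.weakTop fun f hf hM => ?_
  obtain ⟨M, hM⟩ := hM
  let F : (V → ℝ) → ℝ := fun ω => if h : ω ∈ Ωt then f ⟨ω, h⟩ else 0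
  have hFf : ∀ ω : ↥Ωt, F ω = f ω := fun ω => dif_pos ω.2
  have h_integral : ∀ μ : ProbabilityMeasure (V → ℝ),
      ∫ ω, f ω ∂(μ : Measure (V → ℝ)).comap (Subtype.val : ↥Ωt → V → ℝ) =
        ∫ ω, F ω ∂(μ : Measure (V → ℝ)) := fun μ => by
    simp only [← hFf]
    rw [integral_subtype_comap hΩm F]
    exact setIntegral_eq_integral_of_forall_compl_eq_zero fun ω hω => dif_neg hω
  simp only [h_integral]
  refine continuousOn_integral_of_forall_continuousOn (M := |M|)
    (fun n => (isCompact_bddConfig hc hp0 (level_ne_top D n)).isClosed) (fun μ hμ => hμ)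
    (fun ω => ?_) fun n => ?_
  · by_cases h : ω ∈ Ωt
    · simpa only [F, dif_pos h] using (hM _).trans (le_abs_self M)
    · simp [F, dif_neg h]
  · rw [continuousOn_iff_continuous_domRestrict]
    refine (hf.comp (continuous_inclusion_bddConfig hc hp0 hw (level_ne_top D n) hΩ
      (hs n))).congr fun ω => ?_
    exact (hFf ⟨ω.1, hs n ω.2⟩).symm

lemma measure_compl_eq_zero_of_mem_tightSet {Ωt : Set (V → ℝ)}
    (hΩ : Ωt = {ω | ∀ j, eNorm G o (pS j) (αS j) ω ≠ ⊤}) {D : ℕ → ℝ≥0}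
    {μ : ProbabilityMeasure (V → ℝ)} (hμ : μ ∈ tightSet G o pS αS D) :
    (μ : Measure (V → ℝ)) Ωtᶜ = 0 := by
  refine measure_mono_null (Set.compl_subset_compl.mpr ?_) (measure_compl_iUnion_eq_zero hμ)
  exact Set.iUnion_subset fun n => bddConfig_level_subset hΩ D n

end WeakTopology

/-- **Theorem 4.** Let `Ω̃^t = ⋂_{p ∈ [p₀,q)} ⋂_{α ∈ (α_,ᾱ]} L^p(V,w_α)`, endowed with the
projective limit topology, and let `𝒢̃^t` be the set of Gibbs measures supported by `Ω̃^t`,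
regarded as probability measures on `Ω̃^t`. Then `𝒢̃^t` is non-empty and compact in the
weak topology of probability measures on `Ω̃^t`. -/
theorem frechet_tempered_gibbs_fields_nonempty_compact
    (G : SimpleGraph V) [∀ v : V, Fintype (G.neighborSet v)] (hconn : G.Connected)
    (o : V) (θ : ℝ) (hθ : 0 < θ)
    (αlow αbar : ℝ) (hαlow : αlow = sInf {α : ℝ | ThetaFin G o α θ})
    (hbar : αlow < αbar) (hΘ : ∀ α ∈ Set.Ioc αlow αbar, ThetaFin G o α θ)
    (W : ℝ → ℝ → ℝ) (hWcont : Continuous (Function.uncurry W))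
    (hWsym : ∀ u v : ℝ, W u v = W v u)
    (IW JW r : ℝ) (hIW : 0 < IW) (hJW : 0 < JW) (hr : 0 < r)
    (hW : ∀ u v : ℝ, |W u v| ≤ (IW + JW * (|u| ^ r + |v| ^ r)) / 2)
    (P : ℝ → ℝ) (hPcont : Continuous P)
    (aV cV q : ℝ) (haV : 0 < aV) (hcV : 0 < cV) (hq : r + r / θ < q)
    (hP : ∀ u : ℝ, aV * |u| ^ q - cV ≤ P u)
    (p0 : ℝ) (hp0 : p0 = r + r / θ)
    (Ωt : Set (V → ℝ))
    (hΩt : Ωt = ⋂ p ∈ Set.Ico p0 q, ⋂ α ∈ Set.Ioc αlow αbar, tempered G o p α) :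
    Set.Nonempty {ν : Measure ↥Ωt |
        IsProbabilityMeasure ν ∧ IsGibbsMeasure G W P (ν.map Subtype.val)} ∧
    @IsCompact (Measure ↥Ωt) (weakTop ↥Ωt (projTop G o p0 q αlow αbar Ωt))
      {ν : Measure ↥Ωt |
        IsProbabilityMeasure ν ∧ IsGibbsMeasure G W P (ν.map Subtype.val)} := by
  subst hp0
  have hrθ : 0 < r / θ := by positivity
  have hp0 : 0 < r + r / θ := by positivity
  have h : IsStable W P IW JW r aV cV q :=
    ⟨hWcont, hWsym, hIW, hJW, hr, hW, hPcont, haV, by linarith, hP⟩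
  have hw : ∀ α ∈ Set.Ioc αlow αbar, Summable (wgt G o α) := fun α hα =>
    summable_wgt hconn o hθ.le (hΘ α hα)
  obtain ⟨pS, αS, hc⟩ := exists_isExhausting hq hbar
  have hΩ := hΩt.trans (iInter_tempered_eq hc hp0 hw)
  have hΩm : MeasurableSet Ωt := by
    rw [hΩ, Set.ofPred_forall]
    exact MeasurableSet.iInter fun j =>
      (measurable_eNorm (G := G) o (pS j) (αS j)) (measurableSet_singleton ⊤).compl
  have hD : ∀ j, ∃ C : ℝ≥0, ∀ (Λ : Finset V) (ξ : V → ℝ),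
      ∫⁻ ω, eNorm G o (pS j) (αS j) ω ∂gibbsKer G W P Λ ξ ≤
        C + 2 * eTail G o (pS j) (αS j) Λ ξ := fun j => by
    have hj := (hc.memp j).1
    refine exists_lintegral_eNorm_le h hconn o (by linarith) (hc.memp j).2 ?_
      (hw _ (hc.memα j)) (hΘ _ (hc.memα j))
    rw [div_le_iff₀ (by linarith), ← div_le_iff₀' hθ]
    linarith
  choose D hD using hD
  have hcpt := isCompact_inter_isGibbsMeasure (G := G) h
    (isCompact_tightSet (G := G) (o := o) hc hp0 D)
    fun Λ => by
      refine ⟨⟨gibbsKer G W P Λ 0, isProbabilityMeasure_gibbsKer h Λ 0⟩,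
        mem_tightSet_of_forall fun j R hR hR' => ?_, rfl⟩
      refine measure_eNorm_le_of_lintegral_le o (pS j) (αS j) ((hD j Λ 0).trans ?_) hR hR'
      rw [eTail_zero o (hp0.trans_le (hc.memp j).1).ne', mul_zero, add_zero]
      exact le_self_add
  have hval : MeasurableEmbedding (Subtype.val : ↥Ωt → V → ℝ) :=
    MeasurableEmbedding.subtype_coe hΩm
  have himage : {ν : Measure ↥Ωt |
      IsProbabilityMeasure ν ∧ IsGibbsMeasure G W P (ν.map Subtype.val)} =
      (fun μ : ProbabilityMeasure (V → ℝ) =>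
        (μ : Measure (V → ℝ)).comap (Subtype.val : ↥Ωt → V → ℝ)) ''
        (tightSet G o pS αS D ∩ {μ | IsGibbsMeasure G W P (μ : Measure (V → ℝ))}) := by
    ext ν
    constructor
    · rintro ⟨hν, hG⟩
      refine ⟨⟨ν.map Subtype.val, hG.1⟩, ⟨mem_tightSet_of_forall fun j R hR hR' =>
        hG.measure_eNorm_le h o (hD j) ?_ hR hR', hG⟩, hval.comap_map ν⟩
      rw [hval.ae_map_iff]
      exact ae_of_all _ fun ω => hΩ.subset ω.2 j
    · rintro ⟨μ, ⟨hμT, hμG⟩, rfl⟩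
      have hmap : ((μ : Measure (V → ℝ)).comap (Subtype.val : ↥Ωt → V → ℝ)).map Subtype.val =
          (μ : Measure (V → ℝ)) := by
        rw [hval.map_comap, Subtype.range_coe]
        exact Measure.restrict_eq_self_of_ae_mem
          (mem_ae_iff.mpr (measure_compl_eq_zero_of_mem_tightSet hΩ hμT))
      refine ⟨⟨?_⟩, ?_⟩
      · rw [← Set.preimage_univ (f := (Subtype.val : ↥Ωt → V → ℝ)), ← hval.map_apply, hmap]
        exact measure_univ
      · rwa [hmap]
  rw [himage]
  refine ⟨hcpt.1.image _, ?_⟩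
  let := weakTop ↥Ωt (projTop G o (r + r / θ) q αlow αbar Ωt)
  exact hcpt.2.image_of_continuousOn
    ((continuousOn_comap_val hc hp0 hw hΩ hΩm D).mono Set.inter_subset_left)
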